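/- arXiv:1211.0327 — 5 statements merged into one kernel-verified Lean document; each statement's English description precedes it below -/
import Mathlib

section
/- Let λ ≥ 0, let b : [−1,1] → ℝ be continuous, and let f : ℝ³ → ℝ be a Schwartz function. Then the collision operator conserves mass, momentum, and energy: ∫_{ℝ³} Q(f,f)(v) dv = 0, ∫_{ℝ³} Q(f,f)(v) v dv = 0 (componentwise), and ∫_{ℝ³} Q(f,f)(v) |v|² dv = 0. -/
open MeasureTheory Metric
open scoped RealInnerProductSpace

namespace BoltzAux

abbrev E3 := EuclideanSpace ℝ (Fin 3)
abbrev S2 := sphere (0 : E3) 1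
abbrev R0 := Set.Ioi (0 : ℝ)
noncomputable abbrev tau : Measure S2 := (volume : Measure E3).toSphere
noncomputable abbrev rho : Measure R0 := Measure.volumeIoiPow (Module.finrank ℝ E3 - 1)

instance : SFinite tau := inferInstance
instance : SigmaFinite rho := inferInstance
instance : SFinite rho := inferInstance
instance : SFinite ((volume : Measure E3).prod tau) := Measure.prod.instSFinite
instance : SFinite (rho.prod (volume : Measure E3)) := Measure.prod.instSFinite
instance : SFinite (tau.prod (rho.prod (volume : Measure E3))) := Measure.prod.instSFinite

lemma mp_polar : MeasurePreserving (fun p : S2 × R0 => (p.2 : ℝ) • (p.1 : E3))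
    (tau.prod rho) volume := by
  have h1 := (Measure.measurePreserving_homeomorphUnitSphereProd (volume : Measure E3))
  have h2 := h1.symm (homeomorphUnitSphereProd E3).toMeasurableEquiv
  have h3 : MeasurePreserving (Subtype.val : ({0}ᶜ : Set E3) → E3)
      ((volume : Measure E3).comap Subtype.val) volume := by
    refine ⟨measurable_subtype_coe, ?_⟩
    rw [map_comap_subtype_coe (measurableSet_singleton _).compl, restrict_compl_singleton]
  exact h3.comp h2

lemma mp_neg : MeasurePreserving (fun s : S2 => -s) tau tau := by
  have hm : Measurable (fun s : S2 => -s) := continuous_neg.measurable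
  refine ⟨hm, ?_⟩
  ext s hs
  rw [Measure.map_apply hm hs, Measure.toSphere_apply' _ hs, Measure.toSphere_apply' _ (hm hs)]
  congr 1
  rw [← Measure.measure_neg]
  congr 1
  ext x
  simp only [Set.mem_neg, Set.mem_smul, Set.mem_image, Set.mem_preimage]
  constructor
  · rintro ⟨r, hr, y, ⟨z, hz, rfl⟩, h⟩
    exact ⟨r, hr, -z, ⟨-z, hz, rfl⟩, by rw [smul_neg, h, neg_neg]⟩
  · rintro ⟨r, hr, y, ⟨z, hz, rfl⟩, h⟩
    exact ⟨r, hr, -z, ⟨-z, by simpa using hz, rfl⟩, by rw [smul_neg, h]⟩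

lemma mp_lin : MeasurePreserving (fun p : E3 × E3 =>
      (p.2 + (1/2 : ℝ) • p.1, p.2 - (1/2 : ℝ) • p.1))
    ((volume : Measure E3).prod volume) (volume.prod volume) := by
  have h1 : MeasurePreserving (fun p : E3 × E3 => (p.1, p.2 + (1/2 : ℝ) • p.1))
      ((volume : Measure E3).prod volume) (volume.prod volume) :=
    (MeasurePreserving.id volume).skew_product (g := fun a c => c + (1/2 : ℝ) • a)
      (by fun_prop) (ae_of_all _ fun a => map_add_right_eq_self _ _)
  have h2 : MeasurePreserving (fun p : E3 × E3 => (p.1, p.1 - p.2))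
      ((volume : Measure E3).prod volume) (volume.prod volume) :=
    (MeasurePreserving.id volume).skew_product (g := fun a c => a - c)
      (by fun_prop) (ae_of_all _ fun a => (Measure.measurePreserving_sub_left volume a).map_eq)
  have h3 := (h2.comp Measure.measurePreserving_swap).comp h1
  convert h3 using 1
  ext1 p
  simp only [Function.comp, Prod.swap, Prod.mk.injEq, true_and]
  module

noncomputable abbrev nu : Measure ((S2 × S2) × (R0 × E3)) := (tau.prod tau).prod (rho.prod volume)

noncomputable def Pi (p : (S2 × S2) × (R0 × E3)) : E3 × (E3 × S2) :=
  (p.2.2 + (1/2 : ℝ) • ((p.2.1 : ℝ) • (p.1.1 : E3)),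
    (p.2.2 - (1/2 : ℝ) • ((p.2.1 : ℝ) • (p.1.1 : E3)), p.1.2))

lemma mp_Pi : MeasurePreserving Pi nu (volume.prod (volume.prod tau)) := by
  have a1 : MeasurePreserving (fun p : (S2 × S2) × (R0 × E3) => (p.1.1, (p.1.2, p.2)))
      nu (tau.prod (tau.prod (rho.prod volume))) := measurePreserving_prodAssoc _ _ _
  have a2 : MeasurePreserving (fun p : S2 × (S2 × (R0 × E3)) => (p.1, (p.2.2, p.2.1)))
      (tau.prod (tau.prod (rho.prod volume))) (tau.prod ((rho.prod volume).prod tau)) :=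
    (MeasurePreserving.id _).prod Measure.measurePreserving_swap
  have a3 : MeasurePreserving (fun p : S2 × ((R0 × E3) × S2) => ((p.1, p.2.1), p.2.2))
      (tau.prod ((rho.prod volume).prod tau)) ((tau.prod (rho.prod volume)).prod tau) :=
    (measurePreserving_prodAssoc tau (rho.prod (volume : Measure E3)) tau).symm
  have a4 : MeasurePreserving (fun p : S2 × (R0 × E3) => ((p.1, p.2.1), p.2.2))
      (tau.prod (rho.prod volume)) ((tau.prod rho).prod volume) :=
    (measurePreserving_prodAssoc tau rho (volume : Measure E3)).symm
  have a5 := mp_lin.comp ((mp_polar.prod (MeasurePreserving.id (volume : Measure E3))).comp a4)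
  have a6 := (a5.prod (MeasurePreserving.id tau)).comp (a3.comp (a2.comp a1))
  exact (measurePreserving_prodAssoc _ _ _).comp a6

lemma mp_swap : MeasurePreserving (fun p : (S2 × S2) × (R0 × E3) => ((p.1.2, p.1.1), p.2)) nu nu :=
  Measure.measurePreserving_swap.prod (MeasurePreserving.id _)

lemma mp_neg2 : MeasurePreserving (fun p : (S2 × S2) × (R0 × E3) => ((-p.1.1, -p.1.2), p.2)) nu nu :=
  (mp_neg.prod mp_neg).prod (MeasurePreserving.id _)

lemma integrable_weight (f : SchwartzMap E3 ℝ) (n : ℕ) :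
    Integrable (fun v => (1 + ‖v‖) ^ n * |f v|) := by
  have : (fun v => (1 + ‖v‖) ^ n * |f v|) = fun v =>
      ∑ m ∈ Finset.range (n+1), (n.choose m : ℝ) * (‖v‖ ^ m * ‖f v‖) := by
    ext v
    rw [add_comm, add_pow, Finset.sum_mul]
    refine Finset.sum_congr rfl fun m _ => ?_
    simp; ring
  rw [this]
  exact integrable_finsetSum _ fun m _ => (f.integrable_pow_mul volume m).const_mul _

noncomputable def P0 (lam : ℝ) (f : SchwartzMap E3 ℝ) (p : E3 × (E3 × S2)) : ℝ :=
  ‖p.1 - p.2.1‖ ^ lam * (1 + ‖p.1‖ ^ 2 + ‖p.2.1‖ ^ 2) * (|f p.2.1| * |f p.1|)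

lemma integrable_P0 (lam : ℝ) (hlam : 0 ≤ lam) (f : SchwartzMap E3 ℝ) :
    Integrable (P0 lam f) (volume.prod (volume.prod tau)) := by
  obtain ⟨k, hk⟩ := exists_nat_ge lam
  have hw := integrable_weight f (k + 2)
  have h := hw.mul_prod (hw.mul_prod (integrable_const (1:ℝ) : Integrable (fun _ : S2 => (1:ℝ)) tau))
  refine h.mono' ?_ (ae_of_all _ fun p => ?_)
  · have := f.continuous
    apply Measurable.aestronglyMeasurable
    unfold P0
    fun_prop
  · obtain ⟨v, w, s⟩ := p
    simp only [P0, mul_one]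
    rw [Real.norm_of_nonneg (by positivity)]
    have hv := norm_nonneg v
    have hw := norm_nonneg w
    have h1 : ‖v - w‖ ^ lam ≤ ((1 + ‖v‖) * (1 + ‖w‖)) ^ k := by
      calc ‖v - w‖ ^ lam ≤ ((1 + ‖v‖) * (1 + ‖w‖)) ^ lam := by
            apply Real.rpow_le_rpow (norm_nonneg _) _ hlam
            nlinarith [norm_sub_le v w, mul_nonneg hv hw]
        _ ≤ ((1 + ‖v‖) * (1 + ‖w‖)) ^ (k : ℝ) := by
            apply Real.rpow_le_rpow_of_exponent_le _ hk
            nlinarith [mul_nonneg hv hw]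
        _ = _ := Real.rpow_natCast _ _
    have h2 : 1 + ‖v‖ ^ 2 + ‖w‖ ^ 2 ≤ ((1 + ‖v‖) * (1 + ‖w‖)) ^ 2 := by
      have : 0 ≤ ‖v‖ * ‖w‖ := by positivity
      nlinarith [mul_nonneg this hv, mul_nonneg this hw, mul_nonneg this this]
    calc _ ≤ ((1 + ‖v‖) * (1 + ‖w‖)) ^ k * ((1 + ‖v‖) * (1 + ‖w‖)) ^ 2 * (|f w| * |f v|) := by
          gcongr
      _ = _ := by rw [mul_pow, mul_pow]; ring

lemma integral_comp_mp {α β : Type*} [MeasurableSpace α] [MeasurableSpace β] {μ : Measure α}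
    {ν : Measure β} {T : α → β} (hT : MeasurePreserving T μ ν) {g : β → ℝ}
    (hg : AEStronglyMeasurable g ν) : ∫ x, g (T x) ∂μ = ∫ y, g y ∂ν := by
  rw [← hT.map_eq] at hg ⊢
  exact (integral_map hT.measurable.aemeasurable hg).symm

/-- The weighted integrand. -/
noncomputable def G (lam : ℝ) (b : ℝ → ℝ) (f : SchwartzMap E3 ℝ) (φ : E3 → ℝ)
    (p : E3 × (E3 × S2)) : ℝ :=
  ‖p.1 - p.2.1‖ ^ lam * b (⟪p.1 - p.2.1, (p.2.2 : E3)⟫ / ‖p.1 - p.2.1‖) *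
    (f (p.2.1 - (1/2 : ℝ) • (‖p.1 - p.2.1‖ • (p.2.2 : E3) - (p.1 - p.2.1))) *
      f (p.1 + (1/2 : ℝ) • (‖p.1 - p.2.1‖ • (p.2.2 : E3) - (p.1 - p.2.1))) -
      f p.2.1 * f p.1) * φ p.1

lemma G_meas (lam : ℝ) (b : ℝ → ℝ) (hb : Continuous b) (f : SchwartzMap E3 ℝ) (φ : E3 → ℝ)
    (hφ : Continuous φ) : Measurable (G lam b f φ) := by
  have := f.continuous
  unfold G
  fun_prop

noncomputable def H (lam : ℝ) (b : ℝ → ℝ) (f : SchwartzMap E3 ℝ) (φ : E3 → ℝ)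
    (o s : S2) (r : ℝ) (c : E3) : ℝ :=
  r ^ lam * b ⟪(o : E3), (s : E3)⟫ *
    (f (c - (1/2 : ℝ) • (r • (s : E3))) * f (c + (1/2 : ℝ) • (r • (s : E3))) -
     f (c - (1/2 : ℝ) • (r • (o : E3))) * f (c + (1/2 : ℝ) • (r • (o : E3)))) *
      φ (c + (1/2 : ℝ) • (r • (o : E3)))

lemma norm_S2 (o : S2) : ‖(o : E3)‖ = 1 := by simp

lemma rel_u (r : ℝ) (o c : E3) :
    (c + (1/2 : ℝ) • (r • o)) - (c - (1/2 : ℝ) • (r • o)) = r • o := by module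

lemma G_Pi (lam : ℝ) (b : ℝ → ℝ) (f : SchwartzMap E3 ℝ) (φ : E3 → ℝ)
    (p : (S2 × S2) × (R0 × E3)) :
    G lam b f φ (Pi p) = H lam b f φ p.1.1 p.1.2 p.2.1 p.2.2 := by
  obtain ⟨⟨o, s⟩, ⟨r, hr⟩, c⟩ := p
  have hr' : 0 < r := hr
  have hn : ‖r • (o : E3)‖ = r := by rw [norm_smul, norm_S2, Real.norm_of_nonneg hr'.le, mul_one]
  simp only [G, Pi, H, rel_u, hn]
  rw [real_inner_smul_left, mul_div_cancel_left₀ _ hr'.ne']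
  have e1 : c - (1/2 : ℝ) • (r • (o : E3)) - (1/2 : ℝ) • (r • (s : E3) - r • (o : E3)) =
    c - (1/2 : ℝ) • (r • (s : E3)) := by module
  have e2 : c + (1/2 : ℝ) • (r • (o : E3)) + (1/2 : ℝ) • (r • (s : E3) - r • (o : E3)) =
    c + (1/2 : ℝ) • (r • (s : E3)) := by module
  rw [e1, e2]

lemma P0_Pi (lam : ℝ) (f : SchwartzMap E3 ℝ) (p : (S2 × S2) × (R0 × E3)) :
    P0 lam f (Pi p) = (p.2.1 : ℝ) ^ lam * (1 + 2 * ‖p.2.2‖ ^ 2 + (p.2.1 : ℝ) ^ 2 / 2) *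
      (|f (p.2.2 - (1/2 : ℝ) • ((p.2.1 : ℝ) • (p.1.1 : E3)))| *
        |f (p.2.2 + (1/2 : ℝ) • ((p.2.1 : ℝ) • (p.1.1 : E3)))|) := by
  obtain ⟨⟨o, s⟩, ⟨r, hr⟩, c⟩ := p
  have hr' : 0 < r := hr
  have hn : ‖r • (o : E3)‖ = r := by rw [norm_smul, norm_S2, Real.norm_of_nonneg hr'.le, mul_one]
  simp only [P0, Pi, rel_u, hn]
  congr 2
  have := parallelogram_law_with_norm ℝ c ((1/2 : ℝ) • (r • (o : E3)))
  rw [norm_smul (1/2 : ℝ), hn, Real.norm_of_nonneg (by norm_num)] at this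
  nlinarith [this]

lemma integrable_G (lam : ℝ) (hlam : 0 ≤ lam) (b : ℝ → ℝ) (hb : Continuous b) (M : ℝ)
    (hM : ∀ x, |b x| ≤ M) (f : SchwartzMap E3 ℝ) (φ : E3 → ℝ)
    (hφ : Continuous φ) (hφ1 : ∀ v, |φ v| ≤ 1 + ‖v‖ ^ 2) :
    Integrable (G lam b f φ) (volume.prod (volume.prod tau)) := by
  have hG := G_meas lam b hb f φ hφ
  have hP : Integrable (fun p => P0 lam f (Pi p)) nu :=
    mp_Pi.integrable_comp_of_integrable (integrable_P0 lam hlam f)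
  have hP' : Integrable (fun p : (S2 × S2) × (R0 × E3) => P0 lam f (Pi ((p.1.2, p.1.1), p.2))) nu :=
    mp_swap.integrable_comp_of_integrable hP
  rw [← mp_Pi.map_eq, integrable_map_measure hG.aestronglyMeasurable mp_Pi.measurable.aemeasurable]
  refine ((hP.add hP').const_mul M).mono'
    (hG.comp mp_Pi.measurable).aestronglyMeasurable (ae_of_all _ fun p => ?_)
  simp only [Function.comp, Pi.add_apply, P0_Pi, G_Pi, H, Real.norm_eq_abs, abs_mul]
  obtain ⟨⟨o, s⟩, ⟨r, hr⟩, c⟩ := p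
  have hr' : 0 < r := hr
  simp only
  have hn : ‖r • (o : E3)‖ = r := by rw [norm_smul, norm_S2, Real.norm_of_nonneg hr'.le, mul_one]
  have h1 : |φ (c + (1/2 : ℝ) • (r • (o : E3)))| ≤ 1 + 2 * ‖c‖ ^ 2 + r ^ 2 / 2 := by
    refine (hφ1 _).trans ?_
    have := parallelogram_law_with_norm ℝ c ((1/2 : ℝ) • (r • (o : E3)))
    rw [norm_smul (1/2 : ℝ), hn, Real.norm_of_nonneg (by norm_num)] at this
    nlinarith [this, sq_nonneg ‖c - (1/2 : ℝ) • (r • (o : E3))‖]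
  have h2 := abs_sub (f (c - (1/2 : ℝ) • (r • (s : E3))) * f (c + (1/2 : ℝ) • (r • (s : E3))))
     (f (c - (1/2 : ℝ) • (r • (o : E3))) * f (c + (1/2 : ℝ) • (r • (o : E3))))
  rw [abs_mul, abs_mul] at h2
  have hM0 : 0 ≤ M := (abs_nonneg _).trans (hM 0)
  rw [abs_of_nonneg (Real.rpow_nonneg hr'.le lam)]
  have hrp := Real.rpow_nonneg hr'.le lam
  calc _ ≤ r ^ lam * M *
          (|f (c - (1/2 : ℝ) • (r • (s : E3)))| * |f (c + (1/2 : ℝ) • (r • (s : E3)))| +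
           |f (c - (1/2 : ℝ) • (r • (o : E3)))| * |f (c + (1/2 : ℝ) • (r • (o : E3)))|) * (1 + 2 * ‖c‖ ^ 2 + r ^ 2 / 2) := by
        gcongr
        · exact hM _
    _ = _ := by ring

lemma integral_G (lam : ℝ) (hlam : 0 ≤ lam) (b : ℝ → ℝ) (hb : Continuous b) (M : ℝ)
    (hM : ∀ x, |b x| ≤ M) (f : SchwartzMap E3 ℝ) (φ : E3 → ℝ)
    (hφ : Continuous φ) (hφ1 : ∀ v, |φ v| ≤ 1 + ‖v‖ ^ 2)
    (hφ2 : ∀ (c : E3) (r : ℝ) (o s : S2),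
      φ (c + (1/2 : ℝ) • (r • (o : E3))) + φ (c - (1/2 : ℝ) • (r • (o : E3))) =
      φ (c + (1/2 : ℝ) • (r • (s : E3))) + φ (c - (1/2 : ℝ) • (r • (s : E3)))) :
    ∫ p, G lam b f φ p ∂(volume.prod (volume.prod tau)) = 0 := by
  have hG := integrable_G lam hlam b hb M hM f φ hφ hφ1
  have i1 : Integrable (fun p => G lam b f φ (Pi p)) nu := mp_Pi.integrable_comp_of_integrable hG
  rw [← integral_comp_mp mp_Pi hG.aestronglyMeasurable]
  simp only [G_Pi] at i1 ⊢
  have i2 := mp_swap.integrable_comp_of_integrable i1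
  have i3 := mp_neg2.integrable_comp_of_integrable i1
  have i4 := mp_neg2.integrable_comp_of_integrable i2
  have e2 := integral_comp_mp mp_swap i1.aestronglyMeasurable
  have e3 := integral_comp_mp mp_neg2 i1.aestronglyMeasurable
  have e4 := integral_comp_mp mp_neg2 i2.aestronglyMeasurable
  simp only [Function.comp_def] at i2 i3 i4 e2 e3 e4
  have key := integral_add (i1.add i2) (i3.add i4)
  rw [integral_add' i1 i2, integral_add' i3 i4, e4, e3, e2] at key
  have z : ∀ p : (S2 × S2) × (R0 × E3), H lam b f φ p.1.1 p.1.2 p.2.1 p.2.2 +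
      H lam b f φ p.1.2 p.1.1 p.2.1 p.2.2 + (H lam b f φ (-p.1.1) (-p.1.2) p.2.1 p.2.2 +
      H lam b f φ (-p.1.2) (-p.1.1) p.2.1 p.2.2) = 0 := by
    rintro ⟨⟨o, s⟩, r, c⟩
    have h := hφ2 c r o s
    simp only [H, coe_neg_sphere, inner_neg_neg, smul_neg, sub_neg_eq_add, ← sub_eq_add_neg]
    rw [real_inner_comm]
    linear_combination ((r:ℝ) ^ lam * b ⟪(s : E3), (o : E3)⟫ *
    (f (c - (1/2 : ℝ) • ((r:ℝ) • (s : E3))) * f (c + (1/2 : ℝ) • ((r:ℝ) • (s : E3))) -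
     f (c - (1/2 : ℝ) • ((r:ℝ) • (o : E3))) * f (c + (1/2 : ℝ) • ((r:ℝ) • (o : E3))))) * h
  simp only [Pi.add_apply, z, integral_zero] at key
  linarith

lemma main (lam : ℝ) (hlam : 0 ≤ lam)
    (b : ℝ → ℝ) (hb : ContinuousOn b (Set.Icc (-1) 1))
    (f : SchwartzMap E3 ℝ) (Q : E3 → ℝ)
    (hQ : ∀ v, Q v =
      ∫ vs : E3, ∫ σ : S2,
          ‖v - vs‖ ^ lam * b (⟪v - vs, (σ : E3)⟫ / ‖v - vs‖) *
            (f (vs - (1/2 : ℝ) • (‖v - vs‖ • (σ : E3) - (v - vs))) *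
                f (v + (1/2 : ℝ) • (‖v - vs‖ • (σ : E3) - (v - vs))) -
              f vs * f v) ∂tau)
    (φ : E3 → ℝ) (hφ : Continuous φ) (hφ1 : ∀ v, |φ v| ≤ 1 + ‖v‖ ^ 2)
    (hφ2 : ∀ (c : E3) (r : ℝ) (o s : S2),
      φ (c + (1/2 : ℝ) • (r • (o : E3))) + φ (c - (1/2 : ℝ) • (r • (o : E3))) =
      φ (c + (1/2 : ℝ) • (r • (s : E3))) + φ (c - (1/2 : ℝ) • (r • (s : E3)))) :
    ∫ v, Q v * φ v = 0 := by
  have h11 : (-1 : ℝ) ≤ 1 := by norm_num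
  set b' : ℝ → ℝ := Set.IccExtend h11 ((Set.Icc (-1 : ℝ) 1).domRestrict b) with hb'
  have hbc : Continuous b' := hb.domRestrict.Icc_extend'
  obtain ⟨M, hM⟩ := isCompact_Icc.exists_bound_of_continuousOn hb
  have hM' : ∀ x, |b' x| ≤ M := fun x => hM _ (Set.projIcc (-1 : ℝ) 1 h11 x).2
  have hbb : ∀ (u : E3) (s : S2), b (⟪u, (s : E3)⟫ / ‖u‖) = b' (⟪u, (s : E3)⟫ / ‖u‖) := by
    intro u s
    have hmem : ⟪u, (s : E3)⟫ / ‖u‖ ∈ Set.Icc (-1 : ℝ) 1 := by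
      have := abs_real_inner_div_norm_mul_norm_le_one u (s : E3)
      rw [norm_S2, mul_one] at this
      exact abs_le.1 this
    rw [hb', Set.IccExtend_of_mem _ _ hmem]; rfl
  have hG := integrable_G lam hlam b' hbc M hM' f φ hφ hφ1
  rw [← integral_G lam hlam b' hbc M hM' f φ hφ hφ1 hφ2, integral_prod _ hG]
  refine integral_congr_ae ?_
  filter_upwards [hG.prod_right_ae] with v hv
  rw [integral_prod _ hv, hQ, ← integral_mul_const]
  congr 1; ext vs
  rw [← integral_mul_const]
  congr 1; ext s
  simp only [G, hbb]

end BoltzAux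

/-- The Boltzmann collision operator conserves mass, momentum, and energy. -/
theorem boltzmann_conservation
    (lam : ℝ) (hlam : 0 ≤ lam)
    (b : ℝ → ℝ) (hb : ContinuousOn b (Set.Icc (-1) 1))
    (f : SchwartzMap (EuclideanSpace ℝ (Fin 3)) ℝ)
    (Q : EuclideanSpace ℝ (Fin 3) → ℝ)
    (hQ : ∀ v, Q v =
      ∫ vs : EuclideanSpace ℝ (Fin 3),
        ∫ σ : sphere (0 : EuclideanSpace ℝ (Fin 3)) 1,
          ‖v - vs‖ ^ lam * b (⟪v - vs, (σ : EuclideanSpace ℝ (Fin 3))⟫ / ‖v - vs‖) *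
            (f (vs - (1/2 : ℝ) • (‖v - vs‖ • (σ : EuclideanSpace ℝ (Fin 3)) - (v - vs))) *
                f (v + (1/2 : ℝ) • (‖v - vs‖ • (σ : EuclideanSpace ℝ (Fin 3)) - (v - vs))) -
              f vs * f v)
          ∂(volume : Measure (EuclideanSpace ℝ (Fin 3))).toSphere) :
    (∫ v : EuclideanSpace ℝ (Fin 3), Q v = 0) ∧
      (∀ i : Fin 3, ∫ v : EuclideanSpace ℝ (Fin 3), Q v * v i = 0) ∧
      (∫ v : EuclideanSpace ℝ (Fin 3), Q v * ‖v‖ ^ 2 = 0) := by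
  have key := BoltzAux.main lam hlam b hb f Q hQ
  refine ⟨?_, fun i => ?_, ?_⟩
  · have := key (fun _ => 1) continuous_const (fun v => by simp) (fun _ _ _ _ => rfl)
    simpa using this
  · refine key (fun v => v i) (by fun_prop) (fun v => ?_) (fun c r o s => ?_)
    · have h := PiLp.norm_apply_le v i
      rw [Real.norm_eq_abs] at h
      nlinarith [sq_nonneg (‖v‖ - 1), norm_nonneg v]
    · simp
  · refine key (fun v => ‖v‖ ^ 2) (by fun_prop) (fun v => ?_) (fun c r o s => ?_)
    · rw [abs_of_nonneg (by positivity)]; linarith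
    · have h1 := parallelogram_law_with_norm ℝ c
        ((1/2 : ℝ) • (r • (o : EuclideanSpace ℝ (Fin 3))))
      have h2 := parallelogram_law_with_norm ℝ c
        ((1/2 : ℝ) • (r • (s : EuclideanSpace ℝ (Fin 3))))
      simp only [norm_smul, BoltzAux.norm_S2] at h1 h2
      linarith
end

section
/- Let λ ≥ 0, let b : [−1,1] → ℝ be continuous, and let f : ℝ³ → ℝ be a Schwartz function. Then for every ζ ∈ ℝ³, the Fourier transform of the collision operator takes the weighted-convolution form Q̂(ζ) := (2π)^{−3/2} ∫_{ℝ³} Q(f,f)(v) e^{−i ζ·v} dv = ∫_{ℝ³} G(u,ζ) · ( (2π)^{−3/2} ∫_{ℝ³} f(v) f(v−u) e^{−i ζ·v} dv ) du, where G(u,ζ) = |u|^λ ∫_{S²} b((u·σ)/|u|) (e^{−(i/2)|u| ζ·σ} e^{(i/2) ζ·u} − 1) dσ. -/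
open MeasureTheory Metric
open scoped RealInnerProductSpace

abbrev BE := EuclideanSpace ℝ (Fin 3)
abbrev BS := sphere (0 : BE) 1
noncomputable abbrev bs : Measure BS := (volume : Measure BE).toSphere

instance bs_fin : IsFiniteMeasure bs := inferInstance
instance bs_sf : SFinite ((volume : Measure BE).prod bs) := inferInstance

theorem polar_mp : MeasurePreserving
    (fun q : (BS × Set.Ioi (0:ℝ)) => ((q.2 : ℝ) • (q.1 : BE)))
    (bs.prod (Measure.volumeIoiPow 2)) volume := by
  have h1 := Measure.measurePreserving_homeomorphUnitSphereProd (volume : Measure BE)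
  have hd : Module.finrank ℝ BE - 1 = 2 := by simp
  rw [hd] at h1
  have h2 := MeasurePreserving.symm (homeomorphUnitSphereProd BE).toMeasurableEquiv h1
  have h3 := (measurePreserving_subtype_coe (μa := (volume : Measure BE))
    (measurableSet_singleton (0:BE)).compl).comp h2
  rw [restrict_compl_singleton] at h3
  exact h3

theorem polar_emb : MeasurableEmbedding
    (fun q : (BS × Set.Ioi (0:ℝ)) => ((q.2 : ℝ) • (q.1 : BE))) := 
  (MeasurableEmbedding.subtype_coe (measurableSet_singleton (0:BE)).compl).comp
    (homeomorphUnitSphereProd BE).symm.measurableEmbedding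

theorem swap_lemma (M M' : BE × BS → ℂ)
    (h : ∀ (r : ℝ), 0 < r → ∀ ω σ : BS, M' (r • (ω : BE), σ) = M (r • (σ : BE), ω)) :
    ∫ p, M p ∂((volume : Measure BE).prod bs) = ∫ p, M' p ∂((volume : Measure BE).prod bs) := by
  have hmp := polar_mp.prod (MeasurePreserving.id bs)
  have hemb := polar_emb.prodMap (MeasurableEmbedding.id (α := BS) (mα := inferInstance))
  rw [← hmp.integral_comp hemb M, ← hmp.integral_comp hemb M']
  let e : (BS × Set.Ioi (0:ℝ)) × BS ≃ᵐ (BS × Set.Ioi (0:ℝ)) × BS :=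
    MeasurableEquiv.prodComm.trans ((MeasurableEquiv.prodCongr (MeasurableEquiv.refl _)
      MeasurableEquiv.prodComm).trans MeasurableEquiv.prodAssoc.symm)
  have he : MeasurePreserving (fun q : (BS × Set.Ioi (0:ℝ)) × BS => ((q.2, q.1.2), q.1.1))
      ((bs.prod (Measure.volumeIoiPow 2)).prod bs) ((bs.prod (Measure.volumeIoiPow 2)).prod bs) := by
    have a1 : MeasurePreserving (Prod.swap) ((bs.prod (Measure.volumeIoiPow 2)).prod bs) (bs.prod (bs.prod (Measure.volumeIoiPow 2))) := Measure.measurePreserving_swap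
    have a2 := (MeasurePreserving.id bs).prod (Measure.measurePreserving_swap (μ := bs) (ν := (Measure.volumeIoiPow 2)))
    have a3 := MeasurePreserving.symm _ (measurePreserving_prodAssoc bs (Measure.volumeIoiPow 2) bs)
    exact a3.comp (a2.comp a1)
  have hee : MeasurableEmbedding (fun q : (BS × Set.Ioi (0:ℝ)) × BS => ((q.2, q.1.2), q.1.1)) :=
    e.measurableEmbedding
  rw [← he.integral_comp hee]
  refine integral_congr_ae (Filter.Eventually.of_forall fun q => ?_)
  exact (h q.1.2 q.1.2.2 q.1.1 q.2).symm

theorem exists_bound (lam : ℝ) (hlam : 0 ≤ lam) (f : SchwartzMap BE ℝ) :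
    ∃ C : ℝ, 0 ≤ C ∧ ∀ x y : BE, ‖y - x‖ ^ lam * (|f x| * |f y|) ≤
      C * ((1 + ‖y - x‖) ^ (-4 : ℝ) * (1 + ‖(1/2:ℝ) • (x + y)‖) ^ (-4 : ℝ)) := by
  obtain ⟨n, hn⟩ := exists_nat_ge lam
  let K := 8 + n
  obtain ⟨C, hC⟩ : ∃ C : ℝ, ∀ x, (1 + ‖x‖) ^ K * |f x| ≤ C := by
    refine ⟨2 ^ K * ((Finset.Iic (K, 0)).sup fun m => SchwartzMap.seminorm ℝ (E := BE) (F := ℝ) m.1 m.2) f, fun x => ?_⟩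
    have := SchwartzMap.one_add_le_sup_seminorm_apply (𝕜 := ℝ) (m := (K, 0)) (k := K) (n := 0)
      le_rfl le_rfl f x
    rw [norm_iteratedFDeriv_zero, Real.norm_eq_abs] at this
    exact this
  have hC0 : 0 ≤ C := le_trans (by positivity) (hC 0)
  refine ⟨C * C, by positivity, fun x y => ?_⟩
  set r := ‖y - x‖ with hr
  set w := ‖(1/2:ℝ) • (x + y)‖ with hw
  have hr0 : 0 ≤ r := norm_nonneg _
  have hw0 : 0 ≤ w := norm_nonneg _
  have hx0 := norm_nonneg x
  have hy0 := norm_nonneg y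
  set A := (1 + ‖x‖) * (1 + ‖y‖) with hA
  have hrA : 1 + r ≤ A := by
    have := norm_sub_le y x
    nlinarith [mul_nonneg hx0 hy0]
  have hwA : 1 + w ≤ A := by
    have h1 := norm_add_le x y
    have h2 : w = 1/2 * ‖x+y‖ := by rw [hw, norm_smul]; norm_num
    nlinarith [mul_nonneg hx0 hy0]
  have hA0 : 0 < A := by positivity
  have hrl : r ^ lam ≤ (1 + r) ^ n := by
    rw [← Real.rpow_natCast]
    calc r ^ lam ≤ (1+r)^lam := Real.rpow_le_rpow hr0 (by linarith) hlam
      _ ≤ _ := Real.rpow_le_rpow_of_exponent_le (by linarith) hn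
  have e1 : (1+r)^(-4:ℝ) = ((1+r)^4)⁻¹ := by
    rw [Real.rpow_neg (by linarith)]; norm_cast
  have e2 : (1+w)^(-4:ℝ) = ((1+w)^4)⁻¹ := by
    rw [Real.rpow_neg (by linarith)]; norm_cast
  rw [e1, e2, ← mul_inv, ← div_eq_mul_inv, le_div_iff₀ (by positivity)]
  calc r ^ lam * (|f x| * |f y|) * ((1+r)^4 * (1+w)^4) 
      ≤ (1+r)^n * (|f x| * |f y|) * ((1+r)^4 * (1+w)^4) := by gcongr
    _ ≤ A^n * (|f x| * |f y|) * (A^4 * A^4) := by gcongr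
    _ = ((1 + ‖x‖) ^ K * |f x|) * ((1 + ‖y‖) ^ K * |f y|) := by simp only [hA, K, mul_pow, pow_add]; ring
    _ ≤ C * C := by gcongr <;> apply hC

theorem integrable_main (lam : ℝ) (hlam : 0 ≤ lam) (f : SchwartzMap BE ℝ)
    (β : ℝ → ℝ) (hβ : Continuous β) (D : ℝ) (hD : ∀ x, |β x| ≤ D)
    (X Y : (BE × BS) × BE → BE) (hX : Measurable X) (hY : Measurable Y)
    (hn : ∀ p, ‖Y p - X p‖ = ‖p.1.1‖) (hm : ∀ p, (1/2:ℝ) • (X p + Y p) = p.2 - (1/2:ℝ) • p.1.1)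
    (e : (BE × BS) × BE → ℂ) (he : Measurable e) (he1 : ∀ p, ‖e p‖ = 1) :
    Integrable (fun p : (BE × BS) × BE => 
      ((‖p.1.1‖ ^ lam * β (⟪p.1.1, (p.1.2 : BE)⟫ / ‖p.1.1‖) * (f (X p) * f (Y p)) : ℝ) : ℂ) * e p)
      (((volume : Measure BE).prod bs).prod volume) := by
  obtain ⟨C, hC0, hC⟩ := exists_bound lam hlam f
  have hD0 : 0 ≤ D := (abs_nonneg _).trans (hD 0)
  have hi : Integrable (fun x : BE => (1 + ‖x‖) ^ (-4 : ℝ)) volume :=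
    integrable_one_add_norm (by simp; norm_num)
  have hi1 : Integrable (fun x : BE × BS => (1 + ‖x.1‖) ^ (-4 : ℝ)) 
      ((volume : Measure BE).prod bs) := by
    simpa using hi.mul_prod (integrable_const (1:ℝ) (μ := bs))
  have hi2 : Integrable (fun p : (BE × BS) × BE => 
      (1 + ‖p.1.1‖) ^ (-4 : ℝ) * (1 + ‖p.2 - (1/2:ℝ) • p.1.1‖) ^ (-4:ℝ))
      (((volume : Measure BE).prod bs).prod volume) := by
    have hmp : MeasurePreserving (fun p : (BE × BS) × BE => (p.1, p.2 - (1/2:ℝ) • p.1.1))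
      (((volume : Measure BE).prod bs).prod volume) (((volume : Measure BE).prod bs).prod volume) :=
      MeasurePreserving.skew_product (g := fun (a : BE × BS) (y : BE) => y - (1/2:ℝ) • a.1) (MeasurePreserving.id _) (by fun_prop) 
        (Filter.Eventually.of_forall fun a => (measurePreserving_sub_right volume _).map_eq)
    exact hmp.integrable_comp_of_integrable (hi1.mul_prod hi)
  have hfm : Measurable f := f.continuous.measurable
  have hβm := hβ.measurable
  refine (hi2.const_mul (D * C)).mono' ?_ (Filter.Eventually.of_forall fun p => ?_)
  · refine Measurable.aestronglyMeasurable ?_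
    refine Measurable.mul (Complex.measurable_ofReal.comp ?_) he
    refine Measurable.mul (Measurable.mul ?_ ?_) ?_ <;> fun_prop
  · have := hC (X p) (Y p)
    rw [hn, hm] at this
    rw [norm_mul, he1, mul_one, Complex.norm_real, Real.norm_eq_abs, abs_mul, abs_mul, abs_mul,
      abs_of_nonneg (by positivity : 0 ≤ ‖p.1.1‖ ^ lam)]
    calc _ = |β (⟪p.1.1, (p.1.2 : BE)⟫ / ‖p.1.1‖)| * (‖p.1.1‖ ^ lam * (|f (X p)| * |f (Y p)|)) := by ring
      _ ≤ D * (C * ((1 + ‖p.1.1‖) ^ (-4 : ℝ) * (1 + ‖p.2 - (1/2:ℝ) • p.1.1‖) ^ (-4 : ℝ))) :=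
        mul_le_mul (hD _) this (by positivity) hD0
      _ = _ := by ring

/-- The Fourier transform of the Boltzmann collision operator takes
the form of a weighted convolution in Fourier space. -/
theorem boltzmann_fourier_weighted_convolution
    (lam : ℝ) (hlam : 0 ≤ lam)
    (b : ℝ → ℝ) (hb : ContinuousOn b (Set.Icc (-1) 1))
    (f : SchwartzMap (EuclideanSpace ℝ (Fin 3)) ℝ)
    (Q : EuclideanSpace ℝ (Fin 3) → ℝ)
    (hQ : ∀ v, Q v =
      ∫ vs : EuclideanSpace ℝ (Fin 3),
        ∫ σ : sphere (0 : EuclideanSpace ℝ (Fin 3)) 1,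
          ‖v - vs‖ ^ lam * b (⟪v - vs, (σ : EuclideanSpace ℝ (Fin 3))⟫ / ‖v - vs‖) *
            (f (vs - (1/2 : ℝ) • (‖v - vs‖ • (σ : EuclideanSpace ℝ (Fin 3)) - (v - vs))) *
                f (v + (1/2 : ℝ) • (‖v - vs‖ • (σ : EuclideanSpace ℝ (Fin 3)) - (v - vs))) -
              f vs * f v)
          ∂(volume : Measure (EuclideanSpace ℝ (Fin 3))).toSphere)
    (G : EuclideanSpace ℝ (Fin 3) → EuclideanSpace ℝ (Fin 3) → ℂ)
    (hG : ∀ u ζ, G u ζ =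
      (‖u‖ ^ lam : ℝ) * ∫ σ : sphere (0 : EuclideanSpace ℝ (Fin 3)) 1,
        (b (⟪u, (σ : EuclideanSpace ℝ (Fin 3))⟫ / ‖u‖) : ℂ) *
          (Complex.exp (-(Complex.I / 2) * ‖u‖ * ⟪ζ, (σ : EuclideanSpace ℝ (Fin 3))⟫) *
              Complex.exp ((Complex.I / 2) * ⟪ζ, u⟫) - 1)
        ∂(volume : Measure (EuclideanSpace ℝ (Fin 3))).toSphere) :
    ∀ ζ : EuclideanSpace ℝ (Fin 3),
      ((((2 * Real.pi) ^ ((3 : ℝ) / 2))⁻¹ : ℝ) : ℂ) *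
          ∫ v : EuclideanSpace ℝ (Fin 3), (Q v : ℂ) * Complex.exp (-Complex.I * ⟪ζ, v⟫) =
        ∫ u : EuclideanSpace ℝ (Fin 3),
          G u ζ *
            (((((2 * Real.pi) ^ ((3 : ℝ) / 2))⁻¹ : ℝ) : ℂ) *
              ∫ v : EuclideanSpace ℝ (Fin 3),
                ((f v * f (v - u) : ℝ) : ℂ) * Complex.exp (-Complex.I * ⟪ζ, v⟫)) := by
  intro ζ
  have hle : (-1:ℝ) ≤ 1 := by norm_num
  let β : ℝ → ℝ := Set.IccExtend hle ((Set.Icc (-1:ℝ) 1).domRestrict b)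
  have hβc : Continuous β := (continuousOn_iff_continuous_domRestrict.1 hb).Icc_extend'
  obtain ⟨D, hD⟩ : ∃ D, ∀ x, |β x| ≤ D := by
    obtain ⟨D, hD⟩ := isCompact_Icc.exists_bound_of_continuousOn hb
    exact ⟨D, fun x => hD _ (Set.projIcc (-1:ℝ) 1 hle x).2⟩
  have hbβ : ∀ (u : BE) (σ : BS), b (⟪u, (σ : BE)⟫ / ‖u‖) = β (⟪u, (σ : BE)⟫ / ‖u‖) := by
    intro u σ
    have hσ : ‖(σ : BE)‖ = 1 := by simp
    have h1 : |⟪u, (σ : BE)⟫ / ‖u‖| ≤ 1 := by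
      rw [abs_div, abs_norm]
      refine div_le_one_of_le₀ ?_ (norm_nonneg _)
      simpa [hσ] using abs_real_inner_le_norm u (σ : BE)
    exact (Set.IccExtend_of_mem hle ((Set.Icc (-1:ℝ) 1).domRestrict b) (abs_le.1 h1)).symm
  have hQ' : ∀ v, Q v = ∫ vs : BE, ∫ σ : BS,
      ‖v - vs‖ ^ lam * β (⟪v - vs, (σ : BE)⟫ / ‖v - vs‖) *
            (f (vs - (1/2 : ℝ) • (‖v - vs‖ • (σ : BE) - (v - vs))) *
                f (v + (1/2 : ℝ) • (‖v - vs‖ • (σ : BE) - (v - vs))) -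
              f vs * f v) ∂bs := by
    intro v; rw [hQ]; simp only [hbβ]
  have hG' : ∀ u, G u ζ = (‖u‖ ^ lam : ℝ) * ∫ σ : BS,
        (β (⟪u, (σ : BE)⟫ / ‖u‖) : ℂ) *
          (Complex.exp (-(Complex.I / 2) * ‖u‖ * ⟪ζ, (σ : BE)⟫) *
              Complex.exp ((Complex.I / 2) * ⟪ζ, u⟫) - 1) ∂bs := by
    intro u; rw [hG]; simp only [hbβ]
  clear_value β
  clear hQ hG hbβ
  let e : BE → ℂ := fun x => Complex.exp (-Complex.I * ⟪ζ, x⟫)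
  have hem : Measurable e := by
    have : Continuous e := by fun_prop
    exact this.measurable
  have he1 : ∀ x, ‖e x‖ = 1 := by
    intro x
    have : -Complex.I * (⟪ζ, x⟫ : ℂ) = ((-⟪ζ, x⟫ : ℝ) : ℂ) * Complex.I := by push_cast; ring
    simp only [e]
    rw [this, Complex.norm_exp_ofReal_mul_I]
  have head : ∀ x y, e (x + y) = e x * e y := by
    intro x y
    simp only [e]
    rw [← Complex.exp_add, inner_add_right]; push_cast; ring_nf
  let B : BE × BS → ℝ := fun q => ‖q.1‖ ^ lam * β (⟪q.1, (q.2 : BE)⟫ / ‖q.1‖)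
  let g : (BE × BS) × BE → ℂ := fun p =>
    ((B p.1 * (f (p.2 - (1/2:ℝ) • p.1.1 - (1/2:ℝ) • ‖p.1.1‖ • (p.1.2 : BE)) *
      f (p.2 - (1/2:ℝ) • p.1.1 + (1/2:ℝ) • ‖p.1.1‖ • (p.1.2 : BE))) : ℝ) : ℂ) * e p.2
  let l : (BE × BS) × BE → ℂ := fun p =>
    ((B p.1 * (f (p.2 - p.1.1) * f p.2) : ℝ) : ℂ) * e p.2
  let g' : (BE × BS) × BE → ℂ := fun p =>
    ((B p.1 * (f (p.2 - p.1.1) * f p.2) : ℝ) : ℂ) *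
      e (p.2 + (1/2:ℝ) • (‖p.1.1‖ • (p.1.2 : BE) - p.1.1))
  let m := ((volume : Measure BE).prod bs).prod (volume : Measure BE)
  have hgi : Integrable g m := by
    refine integrable_main lam hlam f β hβc D hD
      (fun p => p.2 - (1/2:ℝ) • p.1.1 - (1/2:ℝ) • ‖p.1.1‖ • (p.1.2 : BE))
      (fun p => p.2 - (1/2:ℝ) • p.1.1 + (1/2:ℝ) • ‖p.1.1‖ • (p.1.2 : BE))
      (by fun_prop) (by fun_prop) (fun p => ?_) (fun p => ?_)
      (fun p => e p.2) (hem.comp measurable_snd) (fun p => he1 _)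
    · have : p.2 - (1/2:ℝ) • p.1.1 + (1/2:ℝ) • ‖p.1.1‖ • (p.1.2 : BE) -
        (p.2 - (1/2:ℝ) • p.1.1 - (1/2:ℝ) • ‖p.1.1‖ • (p.1.2 : BE)) = ‖p.1.1‖ • (p.1.2 : BE) := by
        module
      have hσ : ‖(p.1.2 : BE)‖ = 1 := by simp
      rw [this, norm_smul, hσ]; simp
    · module
  have hli : Integrable l m := by
    refine integrable_main lam hlam f β hβc D hD
      (fun p => p.2 - p.1.1) (fun p => p.2)
      (by fun_prop) (by fun_prop) (fun p => ?_) (fun p => ?_)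
      (fun p => e p.2) (hem.comp measurable_snd) (fun p => he1 _)
    · simp
    · module
  have hg'i : Integrable g' m := by
    refine integrable_main lam hlam f β hβc D hD
      (fun p => p.2 - p.1.1) (fun p => p.2)
      (by fun_prop) (by fun_prop) (fun p => ?_) (fun p => ?_)
      (fun p => e (p.2 + (1/2:ℝ) • (‖p.1.1‖ • (p.1.2 : BE) - p.1.1)))
      (hem.comp (by fun_prop)) (fun p => he1 _)
    · simp
    · module
  have H1 : ∫ v : BE, (Q v : ℂ) * e v = ∫ p, (g p - l p) ∂m := by
    refine Eq.trans ?_ (integral_prod_symm _ (hgi.sub hli)).symm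
    refine integral_congr_ae ?_
    filter_upwards [(hgi.sub hli).prod_left_ae] with v hv
    have hv' : Integrable (fun q : BE × BS => g (q, v) - l (q, v)) (volume.prod bs) := hv
    refine Eq.trans ?_ (integral_prod _ hv').symm
    rw [hQ', ← integral_sub_left_eq_self _ volume v,
      ← integral_complex_ofReal, ← integral_mul_const]
    refine integral_congr_ae (Filter.Eventually.of_forall fun u => ?_)
    simp only
    rw [← integral_complex_ofReal, ← integral_mul_const]
    refine integral_congr_ae (Filter.Eventually.of_forall fun σ => ?_)
    simp only [g, l, B, sub_sub_cancel]
    have x1 : v - u - (1/2:ℝ) • (‖u‖ • (σ : BE) - u) =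
      v - (1/2:ℝ) • u - (1/2:ℝ) • ‖u‖ • (σ : BE) := by module
    have x2 : v + (1/2:ℝ) • (‖u‖ • (σ : BE) - u) =
      v - (1/2:ℝ) • u + (1/2:ℝ) • ‖u‖ • (σ : BE) := by module
    rw [x1, x2]
    push_cast
    ring
  have H2 : ∫ p, g p ∂m = ∫ p, g' p ∂m := by
    rw [integral_prod _ hgi, integral_prod _ hg'i]
    refine swap_lemma _ _ ?_
    intro r hr ω σ
    have hσ : ‖(σ : BE)‖ = 1 := by simp
    have hω : ‖(ω : BE)‖ = 1 := by simp
    have n1 : ‖r • (σ : BE)‖ = r := by rw [norm_smul, hσ, Real.norm_of_nonneg hr.le, mul_one]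
    have n2 : ‖r • (ω : BE)‖ = r := by rw [norm_smul, hω, Real.norm_of_nonneg hr.le, mul_one]
    simp only [g, g', B, n1, n2]
    rw [← integral_add_right_eq_self _ ((1/2:ℝ) • r • (ω : BE)),
      ← integral_add_right_eq_self
        (fun v => (((r ^ lam * β (⟪r • (σ : BE), (ω : BE)⟫ / r) * _ : ℝ) : ℂ) * e v))
        ((1/2:ℝ) • r • (σ : BE))]
    refine integral_congr_ae (Filter.Eventually.of_forall fun w => ?_)
    simp only
    have y0 : ⟪r • (ω : BE), (σ : BE)⟫ = ⟪r • (σ : BE), (ω : BE)⟫ := by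
      rw [real_inner_smul_left, real_inner_smul_left, real_inner_comm]
    have y1 : w + (1/2:ℝ) • r • (ω : BE) - r • (ω : BE) =
      w + (1/2:ℝ) • r • (σ : BE) - (1/2:ℝ) • r • (σ : BE) - (1/2:ℝ) • r • (ω : BE) := by module
    have y2 : w + (1/2:ℝ) • r • (ω : BE) =
      w + (1/2:ℝ) • r • (σ : BE) - (1/2:ℝ) • r • (σ : BE) + (1/2:ℝ) • r • (ω : BE) := by module
    have y3 : w + (1/2:ℝ) • r • (ω : BE) + (1/2:ℝ) • (r • (σ : BE) - r • (ω : BE)) =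
      w + (1/2:ℝ) • r • (σ : BE) := by module
    rw [y3, y1, ← y2, y0]
  have H3 : ∫ p, (g' p - l p) ∂m = ∫ u : BE, G u ζ *
      ∫ v : BE, ((f v * f (v - u) : ℝ) : ℂ) * e v := by
    have hi := hg'i.sub hli
    have hi' : Integrable (fun q : BE × BS => ∫ v, (g' (q, v) - l (q, v))) (volume.prod bs) :=
      hi.integral_prod_left
    have : ∫ p, (g' p - l p) ∂m = ∫ q : BE × BS, (∫ v : BE, (g' (q, v) - l (q, v))) ∂(volume.prod bs) :=
      integral_prod _ hi
    rw [this, integral_prod _ hi']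
    refine integral_congr_ae (Filter.Eventually.of_forall fun u => ?_)
    simp only
    rw [hG', ← integral_const_mul (μ := bs), ← integral_mul_const (μ := bs)]
    refine integral_congr_ae (Filter.Eventually.of_forall fun σ => ?_)
    simp only
    rw [← integral_const_mul]
    refine integral_congr_ae (Filter.Eventually.of_forall fun v => ?_)
    have z : e ((1/2:ℝ) • (‖u‖ • (σ : BE) - u)) =
        Complex.exp (-(Complex.I / 2) * ‖u‖ * ⟪ζ, (σ : BE)⟫) *
              Complex.exp ((Complex.I / 2) * ⟪ζ, u⟫) := by
      simp only [e]
      rw [← Complex.exp_add, inner_smul_right, inner_sub_right, inner_smul_right]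
      push_cast
      ring_nf
    simp only [g', l, B]
    rw [head, z]
    push_cast
    ring
  change _ * ∫ v : BE, (Q v : ℂ) * e v = _
  rw [H1, integral_sub hgi hli, H2, ← integral_sub hg'i hli, H3, ← integral_const_mul]
  refine integral_congr_ae (Filter.Eventually.of_forall fun u => ?_)
  simp only [e]
  ring
end

section
/- Let λ ≥ 0, let b : [−1,1] → ℝ be continuous, let R > 0, let f : ℝ³ → ℝ be a Schwartz function vanishing outside the closed ball of radius R centered at 0, and let L ≥ 2R. Define the truncated convolution weights Ĝ(ξ,ζ) = (2π)^{−3/2} ∫_{|u| ≤ L} G(u,ζ) e^{−i ξ·u} du. Then for every ζ ∈ ℝ³, the Fourier transform of the collision operator is the weighted convolution Q̂(ζ) = ∫_{ℝ³} Ĝ(ξ,ζ) f̂(ζ − ξ) f̂(ξ) dξ. -/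
open MeasureTheory Metric
open scoped RealInnerProductSpace

abbrev E3 := EuclideanSpace ℝ (Fin 3)
abbrev S2 := sphere (0 : E3) 1
noncomputable abbrev muS : Measure S2 := (volume : Measure E3).toSphere

lemma int_bdd {α : Type*} [MeasurableSpace α] {μ : Measure α} {g : α → ℂ}
    (hg : AEStronglyMeasurable g μ) (s : Set α) (hs : μ s < ⊤) (C : ℝ)
    (hC : ∀ x, ‖g x‖ ≤ C) (h0 : ∀ x, x ∉ s → g x = 0) : Integrable g μ := by
  have : IntegrableOn g s μ := IntegrableOn.of_bound hs hg.restrict C (Filter.Eventually.of_forall hC)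
  exact this.integrable_of_forall_notMem_eq_zero h0

lemma polar (g : E3 → ℂ) : ∫ u, g u =
    ∫ p : S2 × Set.Ioi (0:ℝ), g (p.2.1 • p.1.1) ∂(muS.prod (Measure.volumeIoiPow 2)) := by
  have h := (volume : Measure E3).measurePreserving_homeomorphUnitSphereProd.integral_comp
    (Homeomorph.measurableEmbedding _)
    (fun p : S2 × Set.Ioi (0:ℝ) => g (p.2.1 • p.1.1))
  have hd : Module.finrank ℝ E3 - 1 = 2 := by simp
  rw [hd] at h
  have h1 : ∫ u, g u = ∫ u in ({0}ᶜ : Set E3), g u := by rw [restrict_compl_singleton]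
  rw [← h, h1, ← integral_subtype_comap (measurableSet_singleton _).compl]
  congr 1
  ext x
  congr 1
  have hx : ‖(x : E3)‖ ≠ 0 := norm_ne_zero_iff.mpr x.2
  simp [smul_smul, hx]

lemma polar_int {g : E3 → ℂ} (hg : Integrable g) :
    Integrable (fun p : S2 × Set.Ioi (0:ℝ) => g (p.2.1 • p.1.1))
     (muS.prod (Measure.volumeIoiPow 2)) := by
  have h := (volume : Measure E3).measurePreserving_homeomorphUnitSphereProd.integrable_comp_emb
    (Homeomorph.measurableEmbedding _)
    (g := fun p : S2 × Set.Ioi (0:ℝ) => g (p.2.1 • p.1.1))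
  have hd : Module.finrank ℝ E3 - 1 = 2 := by simp
  rw [hd] at h
  rw [← h]
  have h2 : (fun p : S2 × Set.Ioi (0:ℝ) => g (p.2.1 • p.1.1)) ∘ (homeomorphUnitSphereProd E3)
     = fun x => g x.1 := by
    ext x
    have hx : ‖(x : E3)‖ ≠ 0 := norm_ne_zero_iff.mpr x.2
    simp [smul_smul, hx]
  rw [h2]
  exact (MeasurableEmbedding.subtype_coe (measurableSet_singleton _).compl).integrable_map_iff.mp
    (by rw [map_comap_subtype_coe (measurableSet_singleton _).compl]; exact hg.integrableOn)

lemma sphere_swap (H : E3 → E3 → ℂ) (hH : Measurable (fun p : E3 × E3 => H p.1 p.2)) (C ρ : ℝ)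
    (hC : ∀ u x, ‖u‖ = ‖x‖ → ‖H u x‖ ≤ C)
    (h0 : ∀ u x, ‖u‖ = ‖x‖ → ρ < ‖x‖ → H u x = 0) :
    ∫ u : E3, ∫ σ : S2, H u (‖u‖ • σ.1) ∂muS = ∫ u : E3, ∫ σ : S2, H (‖u‖ • σ.1) u ∂muS := by
  have hn : ∀ (u : E3) (σ : S2), ‖(‖u‖ • σ.1)‖ = ‖u‖ := by
    intro u σ; simp [norm_smul]
  have key : ∀ K : E3 → E3 → ℂ, Measurable (fun p : E3 × E3 => K p.1 p.2) →
      (∀ u x, ‖u‖ = ‖x‖ → ‖K u x‖ ≤ C) → (∀ u x, ‖u‖ = ‖x‖ → ρ < ‖x‖ → K u x = 0) →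
      ∫ u : E3, ∫ σ : S2, K u (‖u‖ • σ.1) ∂muS =
        ∫ r : Set.Ioi (0:ℝ), ∫ ω : S2, ∫ σ : S2, K (r.1 • ω.1) (r.1 • σ.1) ∂muS ∂muS
          ∂(Measure.volumeIoiPow 2) := by
    intro K hK hC h0
    have hm : Measurable (fun p : E3 × S2 => K p.1 (‖p.1‖ • p.2.1)) :=
      hK.comp (f := fun p : E3 × S2 => (p.1, ‖p.1‖ • p.2.1)) (by fun_prop)
    have hI : Integrable (fun u : E3 => ∫ σ : S2, K u (‖u‖ • σ.1) ∂muS) := by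
      refine int_bdd (hm.stronglyMeasurable.integral_prod_right).aestronglyMeasurable
        (closedBall 0 ρ) measure_closedBall_lt_top (C * muS.real Set.univ) ?_ ?_
      · intro u
        exact norm_integral_le_of_norm_le_const
          (Filter.Eventually.of_forall fun σ => hC _ _ (hn u σ).symm)
      · intro u hu
        have : ρ < ‖u‖ := by simpa using hu
        simp only [h0 u _ (hn u _).symm ((hn u _).symm ▸ this), integral_zero]
    rw [polar, integral_prod_symm _ (polar_int hI)]
    congr 1; ext r; congr 1; ext ω; congr 1; ext σ
    have : ‖r.1 • ω.1‖ = r.1 := by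
      have := r.2
      simp [norm_smul, abs_of_pos this.out]
    rw [this]
  rw [key H hH hC h0]
  have k2 := key (fun u x => H x u) (hH.comp measurable_swap) (fun u x h => hC _ _ h.symm)
    (fun u x h h' => h0 _ _ h.symm (h ▸ h'))
  rw [k2]
  congr 1; ext r
  rw [integral_integral_swap]
  have hm : Measurable (fun p : S2 × S2 => H (r.1 • p.1.1) (r.1 • p.2.1)) :=
    hH.comp (f := fun p : S2 × S2 => (r.1 • p.1.1, r.1 • p.2.1)) (by fun_prop)
  exact int_bdd hm.aestronglyMeasurable Set.univ (measure_lt_top _ _) C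
    (fun p => hC _ _ (by simp [norm_smul])) (by simp)

lemma shear (Φ : E3 → E3 → ℂ) (hm : Measurable (fun p : E3 × E3 => Φ p.1 p.2)) (C R : ℝ)
    (hC : ∀ w u, ‖Φ w u‖ ≤ C) (h0 : ∀ w u, Φ w u ≠ 0 → ‖w‖ ≤ R ∧ ‖u‖ ≤ 2 * R) :
    (∫ v, ∫ u, Φ (v - (1/2:ℝ) • u) u = ∫ w, ∫ u, Φ w u) ∧
    (∫ w, ∫ u, Φ w u = ∫ u, ∫ v, Φ (v - (1/2:ℝ) • u) u) := by
  have i1 : Integrable (fun p : E3 × E3 => Φ p.1 p.2) (volume.prod volume) := by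
    refine int_bdd hm.aestronglyMeasurable (closedBall 0 R ×ˢ closedBall 0 (2*R)) ?_ C
      (fun p => hC _ _) ?_
    · rw [Measure.prod_prod]
      exact ENNReal.mul_lt_top measure_closedBall_lt_top measure_closedBall_lt_top
    · intro p hp
      by_contra h
      apply hp
      simpa using h0 _ _ h
  have i2 : Integrable (fun p : E3 × E3 => Φ (p.1 - (1/2:ℝ) • p.2) p.2) (volume.prod volume) := by
    have hm2 : Measurable (fun p : E3 × E3 => Φ (p.1 - (1/2:ℝ) • p.2) p.2) :=
      hm.comp (g := fun p : E3 × E3 => Φ p.1 p.2)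
        (f := fun p : E3 × E3 => (p.1 - (1/2:ℝ) • p.2, p.2)) (by fun_prop)
    refine int_bdd hm2.aestronglyMeasurable (closedBall 0 (2*R) ×ˢ closedBall 0 (2*R)) ?_ C
      (fun p => hC _ _) ?_
    · rw [Measure.prod_prod]
      exact ENNReal.mul_lt_top measure_closedBall_lt_top measure_closedBall_lt_top
    · intro p hp
      by_contra h
      apply hp
      obtain ⟨h1, h2⟩ := h0 _ _ h
      have : ‖p.1‖ ≤ ‖p.1 - (1/2:ℝ) • p.2‖ + ‖(1/2:ℝ) • p.2‖ := by
        simpa using norm_add_le (p.1 - (1/2:ℝ) • p.2) ((1/2:ℝ) • p.2)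
      rw [norm_smul (1/2:ℝ)] at this
      norm_num at this h1
      simp
      constructor <;> linarith
  have e : ∫ w, ∫ u, Φ w u = ∫ u, ∫ v, Φ (v - (1/2:ℝ) • u) u := by
    rw [integral_integral_swap i1]
    congr 1; ext u
    exact (integral_sub_right_eq_self (fun w => Φ w u) ((1/2:ℝ) • u)).symm
  refine ⟨?_, e⟩
  rw [e, integral_integral_swap i2]

open scoped FourierTransform in
lemma fourier_part (f : SchwartzMap E3 ℝ) (fhat : E3 → ℂ)
    (hfhat : ∀ ζ, fhat ζ =
      ((((2 * Real.pi) ^ ((3 : ℝ) / 2))⁻¹ : ℝ) : ℂ) *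
        ∫ v : E3, (f v : ℂ) * Complex.exp (-Complex.I * ⟪ζ, v⟫)) :
    Continuous fhat ∧ Integrable fhat ∧ (∃ M, ∀ ξ, ‖fhat ξ‖ ≤ M) ∧ ∀ v, (f v : ℂ) =
      ((((2 * Real.pi) ^ ((3 : ℝ) / 2))⁻¹ : ℝ) : ℂ) *
        ∫ ξ : E3, fhat ξ * Complex.exp (Complex.I * ⟪ξ, v⟫) := by
  let φ : SchwartzMap E3 ℂ := SchwartzMap.postcompCLM (𝕜 := ℝ) Complex.ofRealCLM f
  have hφ : ∀ v, φ v = (f v : ℂ) := fun v => rfl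
  have hpi : (0:ℝ) < 2 * Real.pi := by positivity
  set c : ℝ := ((2 * Real.pi) ^ ((3 : ℝ) / 2))⁻¹ with hc
  have e : ∀ ζ, fhat ζ = (c : ℂ) * (𝓕 φ) ((2 * Real.pi)⁻¹ • ζ) := by
    intro ζ
    rw [hfhat, SchwartzMap.fourier_coe, Real.fourier_eq']
    congr 2; ext v
    rw [hφ, smul_eq_mul, mul_comm]
    congr 2
    rw [inner_smul_right, real_inner_comm]
    push_cast
    have : (Real.pi : ℂ) ≠ 0 := by exact_mod_cast Real.pi_ne_zero
    field_simp
  have he : fhat = fun ζ => (c : ℂ) * (𝓕 φ) ((2 * Real.pi)⁻¹ • ζ) := funext e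
  refine ⟨?_, ?_, ?_, ?_⟩
  · rw [he]
    exact continuous_const.mul ((𝓕 φ).continuous.comp (continuous_const_smul _))
  · rw [he]
    exact ((𝓕 φ).integrable.comp_smul (by positivity)).const_mul _
  · refine ⟨|c| * ∫ v, ‖f v‖, fun ξ => ?_⟩
    rw [hfhat, norm_mul, Complex.norm_real, Real.norm_eq_abs]
    gcongr
    refine (norm_integral_le_integral_norm _).trans (le_of_eq ?_)
    congr 1; ext v
    rw [norm_mul, Complex.norm_exp]
    simp
  · intro v
    have h1 : (𝓕⁻ (𝓕 φ)) v = φ v := by rw [FourierTransform.fourierInv_fourier_eq]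
    rw [← hφ, ← h1, SchwartzMap.fourierInv_coe, Real.fourierInv_eq']
    have h2 := Measure.integral_comp_smul (volume : Measure E3)
      (fun w => Complex.exp (((2 * Real.pi * ⟪w, v⟫ : ℝ) : ℂ) * Complex.I) • (𝓕 φ) w)
      (2 * Real.pi)⁻¹
    have h3 : ∫ ξ : E3, fhat ξ * Complex.exp (Complex.I * ⟪ξ, v⟫) =
        (c : ℂ) * ∫ x : E3, Complex.exp (((2 * Real.pi * ⟪(2 * Real.pi)⁻¹ • x, v⟫ : ℝ) : ℂ)
          * Complex.I) • (𝓕 φ) ((2 * Real.pi)⁻¹ • x) := by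
      rw [← integral_const_mul]
      congr 1; ext x
      rw [e, smul_eq_mul, inner_smul_left]
      have : (2 * Real.pi * ((starRingEnd ℝ) (2 * Real.pi)⁻¹ * ⟪x, v⟫)) = ⟪x, v⟫ := by
        simp only [conj_trivial]; field_simp
      rw [this]; ring_nf
    rw [h3, h2]
    have h4 : c * c * |((2 * Real.pi)⁻¹ ^ Module.finrank ℝ E3)⁻¹| = 1 := by
      have : c * c = ((2 * Real.pi) ^ 3)⁻¹ := by
        rw [hc, ← mul_inv, ← Real.rpow_add hpi]; norm_num
      rw [this, abs_of_pos (by positivity)]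
      simp
      field_simp
    rw [Complex.real_smul]
    rw [← mul_assoc, ← mul_assoc, ← Complex.ofReal_mul, ← Complex.ofReal_mul, h4]
    simp

lemma norm_e (x : ℝ) : ‖Complex.exp (-Complex.I * x)‖ = 1 := by
  rw [Complex.norm_exp]; simp

/-- averaging over the sphere keeps measurability, bounds and support -/
lemma sph_avg (J : E3 → E3 → S2 → ℂ) (hJ : Measurable (fun p : (E3 × E3) × S2 => J p.1.1 p.1.2 p.2))
    (C R : ℝ) (hC : ∀ w u σ, ‖J w u σ‖ ≤ C)
    (h0 : ∀ w u σ, J w u σ ≠ 0 → ‖w‖ ≤ R ∧ ‖u‖ ≤ 2 * R) :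
    Measurable (fun p : E3 × E3 => ∫ σ, J p.1 p.2 σ ∂muS) ∧
    (∀ w u, ‖∫ σ, J w u σ ∂muS‖ ≤ C * muS.real Set.univ) ∧
    (∀ w u, ∫ σ, J w u σ ∂muS ≠ 0 → ‖w‖ ≤ R ∧ ‖u‖ ≤ 2 * R) ∧
    (∀ w u, Integrable (fun σ => J w u σ) muS) ∧
    (∀ w, Integrable (fun u => ∫ σ, J w u σ ∂muS)) := by
  have m : Measurable (fun p : E3 × E3 => ∫ σ, J p.1 p.2 σ ∂muS) :=
    (hJ.stronglyMeasurable.integral_prod_right).measurable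
  have bd : ∀ w u, ‖∫ σ, J w u σ ∂muS‖ ≤ C * muS.real Set.univ := fun w u =>
    norm_integral_le_of_norm_le_const (Filter.Eventually.of_forall fun σ => hC _ _ _)
  have sp : ∀ w u, ∫ σ, J w u σ ∂muS ≠ 0 → ‖w‖ ≤ R ∧ ‖u‖ ≤ 2 * R := by
    intro w u h
    by_contra hh
    apply h
    have : ∀ σ, J w u σ = 0 := fun σ => by
      by_contra h2; exact hh (h0 _ _ _ h2)
    simp [this]
  refine ⟨m, bd, sp, ?_, ?_⟩
  · intro w u
    have : Measurable (fun σ => J w u σ) :=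
      hJ.comp (f := fun σ : S2 => ((w, u), σ)) (by fun_prop)
    exact int_bdd this.aestronglyMeasurable Set.univ (measure_lt_top _ _) C (hC w u) (by simp)
  · intro w
    have : Measurable (fun u => ∫ σ, J w u σ ∂muS) :=
      m.comp (f := fun u : E3 => (w, u)) (by fun_prop)
    refine int_bdd this.aestronglyMeasurable (closedBall 0 (2 * R)) measure_closedBall_lt_top _
      (bd w) ?_
    intro u hu
    by_contra h
    exact hu (by simpa using (sp _ _ h).2)

lemma collision_part (lam : ℝ) (hlam : 0 ≤ lam) (β : ℝ → ℝ) (hβ : Measurable β) (M : ℝ)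
    (hM : ∀ t, |β t| ≤ M) (R : ℝ) (hR : 0 < R) (f : E3 → ℝ) (hf : Measurable f) (N : ℝ)
    (hN : ∀ v, |f v| ≤ N) (hsupp : ∀ v, f v ≠ 0 → ‖v‖ ≤ R) (ζ : E3) :
    ∫ v : E3, ((∫ vs : E3, ∫ σ : S2, ‖v - vs‖ ^ lam * β (⟪v - vs, (σ : E3)⟫ / ‖v - vs‖) *
            (f (vs - (1/2 : ℝ) • (‖v - vs‖ • (σ : E3) - (v - vs))) *
                f (v + (1/2 : ℝ) • (‖v - vs‖ • (σ : E3) - (v - vs))) -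
              f vs * f v) ∂muS : ℝ) : ℂ) * Complex.exp (-Complex.I * ⟪ζ, v⟫) =
    ∫ u : E3, ((‖u‖ ^ lam : ℝ) * ∫ σ : S2,
        (β (⟪u, (σ : E3)⟫ / ‖u‖) : ℂ) *
          (Complex.exp (-(Complex.I / 2) * ‖u‖ * ⟪ζ, (σ : E3)⟫) *
              Complex.exp ((Complex.I / 2) * ⟪ζ, u⟫) - 1) ∂muS) *
       ∫ v : E3, (f v : ℂ) * f (v - u) * Complex.exp (-Complex.I * ⟪ζ, v⟫) := by
  have hM0 : 0 ≤ M := (abs_nonneg _).trans (hM 0)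
  have hN0 : 0 ≤ N := (abs_nonneg _).trans (hN 0)
  have avg : ∀ w x : E3, f (w - (1/2:ℝ) • x) * f (w + (1/2:ℝ) • x) ≠ 0 →
      ‖w‖ ≤ R ∧ ‖x‖ ≤ 2 * R := by
    intro w x h
    have h1 := hsupp _ (left_ne_zero_of_mul h)
    have h2 := hsupp _ (right_ne_zero_of_mul h)
    constructor
    · have := norm_add_le (w - (1/2:ℝ) • x) (w + (1/2:ℝ) • x)
      have e : (w - (1/2:ℝ) • x) + (w + (1/2:ℝ) • x) = (2:ℝ) • w := by module
      rw [e, norm_smul] at this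
      norm_num at this h1 h2
      linarith
    · have := norm_sub_le (w + (1/2:ℝ) • x) (w - (1/2:ℝ) • x)
      have e : (w + (1/2:ℝ) • x) - (w - (1/2:ℝ) • x) = x := by module
      rw [e] at this
      linarith
  let H : E3 → E3 → E3 → E3 → ℂ := fun w u x y =>
    ((‖u‖ ^ lam * β (⟪u, x⟫ / ‖u‖ ^ 2) *
      (f (w - (1/2:ℝ) • y) * f (w + (1/2:ℝ) • y)) : ℝ) : ℂ) *
      Complex.exp (-Complex.I * ⟪ζ, w + (1/2:ℝ) • u⟫)
  have hH : Measurable (fun p : E3 × E3 × E3 × E3 => H p.1 p.2.1 p.2.2.1 p.2.2.2) := by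
    simp only [H]
    fun_prop
  let C : ℝ := (2 * R) ^ lam * M * (N * N)
  have hHC : ∀ w u x y, ‖u‖ = ‖y‖ → ‖H w u x y‖ ≤ C := by
    intro w u x y huy
    by_cases h : f (w - (1/2:ℝ) • y) * f (w + (1/2:ℝ) • y) = 0
    · simp only [H, h, mul_zero, Complex.ofReal_zero, zero_mul, norm_zero, C]
      positivity
    · have h2 := (avg _ _ h).2
      simp only [H, norm_mul, norm_e, mul_one, C, Complex.norm_real, Real.norm_eq_abs]
      rw [abs_of_nonneg (by positivity : 0 ≤ ‖u‖ ^ lam)]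
      gcongr
      · rw [huy]; exact h2
      · exact hM _
      · exact hN _
      · exact hN _
  have hH0 : ∀ w u x y, H w u x y ≠ 0 → ‖w‖ ≤ R ∧ ‖y‖ ≤ 2 * R := by
    intro w u x y h
    apply avg
    intro h2
    apply h
    simp only [H, h2]
    simp
  have hn : ∀ (u : E3) (σ : S2), ‖(‖u‖ • σ.1)‖ = ‖u‖ := by
    intro u σ; simp [norm_smul]
  obtain ⟨mA, bA, sA, iA, jA⟩ := sph_avg (fun w u σ => H w u (‖u‖ • σ.1) (‖u‖ • σ.1))
    (hH.comp (f := fun p : (E3 × E3) × S2 =>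
      (p.1.1, p.1.2, ‖p.1.2‖ • p.2.1, ‖p.1.2‖ • p.2.1)) (by fun_prop)) C R
    (fun w u σ => hHC _ _ _ _ (hn _ _).symm) (fun w u σ h => hn u σ ▸ hH0 _ _ _ _ h)
  obtain ⟨mA', bA', sA', iA', jA'⟩ := sph_avg (fun w u σ => H w (‖u‖ • σ.1) u u)
    (hH.comp (f := fun p : (E3 × E3) × S2 =>
      (p.1.1, ‖p.1.2‖ • p.2.1, p.1.2, p.1.2)) (by fun_prop)) C R
    (fun w u σ => hHC _ _ _ _ (hn _ _)) (fun w u σ h => hH0 _ _ _ _ h)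
  obtain ⟨mB, bB, sB, iB, jB⟩ := sph_avg (fun w u σ => H w u (‖u‖ • σ.1) u)
    (hH.comp (f := fun p : (E3 × E3) × S2 =>
      (p.1.1, p.1.2, ‖p.1.2‖ • p.2.1, p.1.2)) (by fun_prop)) C R
    (fun w u σ => hHC _ _ _ _ rfl) (fun w u σ h => hH0 _ _ _ _ h)
  set A : E3 → E3 → ℂ := fun w u => ∫ σ, H w u (‖u‖ • σ.1) (‖u‖ • σ.1) ∂muS with hA
  set A' : E3 → E3 → ℂ := fun w u => ∫ σ, H w (‖u‖ • σ.1) u u ∂muS with hA'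
  set B : E3 → E3 → ℂ := fun w u => ∫ σ, H w u (‖u‖ • σ.1) u ∂muS with hB
  have swap : ∀ w, ∫ u, A w u = ∫ u, A' w u := by
    intro w
    refine sphere_swap (fun u x => H w u x x) ?_ C (2 * R) ?_ ?_
    · exact hH.comp (f := fun p : E3 × E3 => (w, p.1, p.2, p.2)) (by fun_prop)
    · intro u x h; exact hHC _ _ _ _ h
    · intro u x h h'
      by_contra hh
      exact absurd (hH0 _ _ _ _ hh).2 (not_le.mpr h')
  have s1 := (shear (fun w u => A w u - B w u) (mA.sub mB)
    (C * muS.real Set.univ + C * muS.real Set.univ) R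
    (fun w u => (norm_sub_le _ _).trans (add_le_add (bA w u) (bB w u))) (by
      intro w u h
      by_cases h1 : A w u = 0
      · exact sB w u (fun h2 => h (by rw [h1]; exact (by simpa using h2)))
      · exact sA w u h1)).1
  have s2 := (shear (fun w u => A' w u - B w u) (mA'.sub mB)
    (C * muS.real Set.univ + C * muS.real Set.univ) R
    (fun w u => (norm_sub_le _ _).trans (add_le_add (bA' w u) (bB w u))) (by
      intro w u h
      by_cases h1 : A' w u = 0
      · exact sB w u (fun h2 => h (by rw [h1]; exact (by simpa using h2)))
      · exact sA' w u h1)).2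
  have mid : ∀ w, ∫ u, (A w u - B w u) = ∫ u, (A' w u - B w u) := by
    intro w
    rw [integral_sub (jA w) (jB w), integral_sub (jA' w) (jB w), swap]
  simp only [mid] at s1
  have innr : ∀ (u : E3) (σ : S2), ⟪u, ‖u‖ • σ.1⟫ / ‖u‖ ^ 2 = ⟪u, σ.1⟫ / ‖u‖ := by
    intro u σ
    rw [inner_smul_right]
    by_cases h : ‖u‖ = 0
    · simp [h]
    · field_simp
  have innl : ∀ (u : E3) (σ : S2), ⟪‖u‖ • σ.1, u⟫ / ‖u‖ ^ 2 = ⟪u, σ.1⟫ / ‖u‖ := by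
    intro u σ
    rw [real_inner_comm, innr]
  refine Eq.trans (Eq.trans ?_ (s1.trans s2)) ?_
  · congr 1; ext v
    rw [← integral_sub_left_eq_self _ volume v, ← integral_complex_ofReal, ← integral_mul_const]
    congr 1; ext u
    rw [← integral_complex_ofReal, ← integral_mul_const]
    simp only [hA, hB]
    rw [← integral_sub (iA _ _) (iB _ _)]
    congr 1; ext σ
    simp only [H, innr]
    have e0 : v - (v - u) = u := by abel
    have e1 : v - (1/2:ℝ) • u + (1/2:ℝ) • u = v := by module
    have e2 : v - (1/2:ℝ) • u - (1/2:ℝ) • u = v - u := by module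
    have e3 : v - u - (1/2:ℝ) • (‖u‖ • σ.1 - u) = v - (1/2:ℝ) • u - (1/2:ℝ) • ‖u‖ • σ.1 := by
      module
    have e4 : v + (1/2:ℝ) • (‖u‖ • σ.1 - u) = v - (1/2:ℝ) • u + (1/2:ℝ) • ‖u‖ • σ.1 := by
      module
    rw [e0, e1, e2, e3, e4]
    push_cast
    ring
  · congr 1; ext u
    rw [← integral_const_mul]
    congr 1; ext v
    simp only [hA', hB]
    rw [← integral_sub (iA' _ _) (iB _ _), ← integral_const_mul, ← integral_mul_const]
    congr 1; ext σ
    simp only [H, innr, innl, hn]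
    have e1 : v - (1/2:ℝ) • u + (1/2:ℝ) • u = v := by module
    have e2 : v - (1/2:ℝ) • u - (1/2:ℝ) • u = v - u := by module
    rw [e1, e2]
    have e3 : Complex.exp (-Complex.I * ⟪ζ, v - (1/2:ℝ) • u + (1/2:ℝ) • ‖u‖ • σ.1⟫) =
       Complex.exp (-(Complex.I / 2) * ‖u‖ * ⟪ζ, (σ : E3)⟫) *
              Complex.exp ((Complex.I / 2) * ⟪ζ, u⟫) * Complex.exp (-Complex.I * ⟪ζ, v⟫) := by
      rw [← Complex.exp_add, ← Complex.exp_add]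
      congr 1
      simp only [inner_add_right, inner_sub_right, inner_smul_right]
      push_cast
      ring
    rw [e3]
    push_cast
    ring

lemma conv_part (f : SchwartzMap E3 ℝ) (fhat : E3 → ℂ)
    (hfhat : ∀ ζ, fhat ζ =
      ((((2 * Real.pi) ^ ((3 : ℝ) / 2))⁻¹ : ℝ) : ℂ) *
        ∫ v : E3, (f v : ℂ) * Complex.exp (-Complex.I * ⟪ζ, v⟫)) (ζ u : E3) :
    ∫ v : E3, (f v : ℂ) * f (v - u) * Complex.exp (-Complex.I * ⟪ζ, v⟫) =
      ∫ ξ : E3, fhat (ζ - ξ) * fhat ξ * Complex.exp (-Complex.I * ⟪ξ, u⟫) := by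
  obtain ⟨hc, hi, -, hinv⟩ := fourier_part f fhat hfhat
  set c : ℂ := ((((2 * Real.pi) ^ ((3 : ℝ) / 2))⁻¹ : ℝ) : ℂ) with hcdef
  let T : E3 → E3 → ℂ := fun v ξ => c * (((f v : ℂ) * fhat ξ) *
    (Complex.exp (-Complex.I * ⟪ζ - ξ, v⟫) * Complex.exp (-Complex.I * ⟪ξ, u⟫)))
  have hT : Integrable (fun p : E3 × E3 => T p.1 p.2) (volume.prod volume) := by
    refine Integrable.const_mul ?_ c
    refine (f.integrable.ofReal.mul_prod hi).mul_bdd (c := 1) ?_ ?_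
    · exact Continuous.aestronglyMeasurable (by fun_prop)
    · refine Filter.Eventually.of_forall fun p => ?_
      rw [norm_mul, norm_e, norm_e]; simp
  have h1 : ∀ v, (f v : ℂ) * f (v - u) * Complex.exp (-Complex.I * ⟪ζ, v⟫) = ∫ ξ, T v ξ := by
    intro v
    rw [hinv (v - u)]
    simp only [T]
    rw [integral_const_mul]
    rw [show ∀ (a b I : ℂ), a * (c * I) * b = c * ((a * b) * I) from fun a b I => by ring]
    rw [← integral_const_mul]
    congr 2; ext ξ
    have : Complex.exp (-Complex.I * ⟪ζ - ξ, v⟫) * Complex.exp (-Complex.I * ⟪ξ, u⟫) =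
      Complex.exp (-Complex.I * ⟪ζ, v⟫) * Complex.exp (Complex.I * ⟪ξ, v - u⟫) := by
      rw [← Complex.exp_add, ← Complex.exp_add]
      congr 1
      simp only [inner_sub_left, inner_sub_right]
      push_cast
      ring
    rw [this]; ring
  have h2 : ∀ ξ, fhat (ζ - ξ) * fhat ξ * Complex.exp (-Complex.I * ⟪ξ, u⟫) = ∫ v, T v ξ := by
    intro ξ
    rw [hfhat (ζ - ξ)]
    simp only [T]
    rw [integral_const_mul, mul_assoc, mul_assoc, ← integral_mul_const]
    congr 2; ext v
    ring
  simp only [h1, h2]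
  exact integral_integral_swap hT

/-- With truncated convolution weights over the ball of radius `L ≥ 2R`,
the Fourier transform of the collision operator is a weighted convolution of
Fourier transforms of a distribution supported in the ball of radius `R`. -/
theorem boltzmann_fourier_truncated_weighted_convolution
    (lam : ℝ) (hlam : 0 ≤ lam)
    (b : ℝ → ℝ) (hb : ContinuousOn b (Set.Icc (-1) 1))
    (R : ℝ) (hR : 0 < R) (L : ℝ) (hL : 2 * R ≤ L)
    (f : SchwartzMap (EuclideanSpace ℝ (Fin 3)) ℝ)
    (hsupp : ∀ v : EuclideanSpace ℝ (Fin 3),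
      v ∉ Metric.closedBall (0 : EuclideanSpace ℝ (Fin 3)) R → f v = 0)
    (Q : EuclideanSpace ℝ (Fin 3) → ℝ)
    (hQ : ∀ v, Q v =
      ∫ vs : EuclideanSpace ℝ (Fin 3),
        ∫ σ : sphere (0 : EuclideanSpace ℝ (Fin 3)) 1,
          ‖v - vs‖ ^ lam * b (⟪v - vs, (σ : EuclideanSpace ℝ (Fin 3))⟫ / ‖v - vs‖) *
            (f (vs - (1/2 : ℝ) • (‖v - vs‖ • (σ : EuclideanSpace ℝ (Fin 3)) - (v - vs))) *
                f (v + (1/2 : ℝ) • (‖v - vs‖ • (σ : EuclideanSpace ℝ (Fin 3)) - (v - vs))) -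
              f vs * f v)
          ∂(volume : Measure (EuclideanSpace ℝ (Fin 3))).toSphere)
    (G : EuclideanSpace ℝ (Fin 3) → EuclideanSpace ℝ (Fin 3) → ℂ)
    (hG : ∀ u ζ, G u ζ =
      (‖u‖ ^ lam : ℝ) * ∫ σ : sphere (0 : EuclideanSpace ℝ (Fin 3)) 1,
        (b (⟪u, (σ : EuclideanSpace ℝ (Fin 3))⟫ / ‖u‖) : ℂ) *
          (Complex.exp (-(Complex.I / 2) * ‖u‖ * ⟪ζ, (σ : EuclideanSpace ℝ (Fin 3))⟫) *
              Complex.exp ((Complex.I / 2) * ⟪ζ, u⟫) - 1)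
        ∂(volume : Measure (EuclideanSpace ℝ (Fin 3))).toSphere)
    (Ghat : EuclideanSpace ℝ (Fin 3) → EuclideanSpace ℝ (Fin 3) → ℂ)
    (hGhat : ∀ ξ ζ, Ghat ξ ζ =
      ((((2 * Real.pi) ^ ((3 : ℝ) / 2))⁻¹ : ℝ) : ℂ) *
        ∫ u in Metric.closedBall (0 : EuclideanSpace ℝ (Fin 3)) L,
          G u ζ * Complex.exp (-Complex.I * ⟪ξ, u⟫))
    (fhat : EuclideanSpace ℝ (Fin 3) → ℂ)
    (hfhat : ∀ ζ, fhat ζ =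
      ((((2 * Real.pi) ^ ((3 : ℝ) / 2))⁻¹ : ℝ) : ℂ) *
        ∫ v : EuclideanSpace ℝ (Fin 3), (f v : ℂ) * Complex.exp (-Complex.I * ⟪ζ, v⟫)) :
    ∀ ζ : EuclideanSpace ℝ (Fin 3),
      ((((2 * Real.pi) ^ ((3 : ℝ) / 2))⁻¹ : ℝ) : ℂ) *
          (∫ v : EuclideanSpace ℝ (Fin 3), (Q v : ℂ) * Complex.exp (-Complex.I * ⟪ζ, v⟫)) =
        ∫ ξ : EuclideanSpace ℝ (Fin 3), Ghat ξ ζ * fhat (ζ - ξ) * fhat ξ := by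
  intro ζ
  obtain ⟨hfc, hfi, ⟨F, hF⟩, -⟩ := fourier_part f fhat hfhat
  -- replace `b` by a globally continuous bounded function
  let β : ℝ → ℝ := Set.IccExtend (by norm_num : (-1:ℝ) ≤ 1) (Set.domRestrict (Set.Icc (-1) 1) b)
  have hβc : Continuous β := (continuousOn_iff_continuous_domRestrict.mp hb).Icc_extend'
  obtain ⟨M, hM⟩ : ∃ M, ∀ t, |β t| ≤ M := by
    obtain ⟨M, hM⟩ := isCompact_Icc.exists_bound_of_continuousOn hb
    refine ⟨M, fun t => ?_⟩
    simp only [β, Set.IccExtend, Function.comp]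
    exact hM _ (Subtype.prop _)
  have hbβ : ∀ (u : E3) (σ : S2), b (⟪u, (σ : E3)⟫ / ‖u‖) = β (⟪u, (σ : E3)⟫ / ‖u‖) := by
    intro u σ
    have h1 : |⟪u, (σ : E3)⟫ / ‖u‖| ≤ 1 := by
      rw [abs_div, abs_norm]
      refine div_le_one_of_le₀ ?_ (norm_nonneg _)
      have := abs_real_inner_le_norm u (σ : E3)
      simpa using this
    exact (Set.IccExtend_of_mem _ (Set.domRestrict (Set.Icc (-1) 1) b) (abs_le.mp h1)).symm
  have hM0 : 0 ≤ M := (abs_nonneg _).trans (hM 0)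
  have hN : ∀ v, |f v| ≤ SchwartzMap.seminorm ℝ 0 0 f := fun v => by
    simpa using SchwartzMap.norm_le_seminorm ℝ f v
  have hs : ∀ v, f v ≠ 0 → ‖v‖ ≤ R := by
    intro v h
    by_contra h2
    exact h (hsupp v (by simpa using h2))
  have hcol := collision_part lam hlam β hβc.measurable M hM R hR f f.continuous.measurable _ hN hs ζ
  simp only [hbβ] at hQ hG
  simp only [← hQ, ← hG] at hcol
  have hL0 : 0 ≤ L := by linarith
  -- measurability and boundedness of the weight
  have hGm : Measurable (fun u => G u ζ) := by
    simp only [hG]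
    refine Measurable.mul (by fun_prop) ?_
    have : Measurable (fun p : E3 × S2 => (β (⟪p.1, (p.2 : E3)⟫ / ‖p.1‖) : ℂ) *
          (Complex.exp (-(Complex.I / 2) * ‖p.1‖ * ⟪ζ, (p.2 : E3)⟫) *
              Complex.exp ((Complex.I / 2) * ⟪ζ, p.1⟫) - 1)) := by
      have := hβc.measurable
      fun_prop
    exact (this.stronglyMeasurable.integral_prod_right).measurable
  have hGb : ∀ u ∈ closedBall (0 : E3) L, ‖G u ζ‖ ≤ L ^ lam * (M * 2 * muS.real Set.univ) := by
    intro u hu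
    have hu' : ‖u‖ ≤ L := by simpa using hu
    rw [hG, norm_mul, Complex.norm_real, Real.norm_eq_abs, abs_of_nonneg (by positivity)]
    gcongr
    refine norm_integral_le_of_norm_le_const (Filter.Eventually.of_forall fun σ => ?_)
    rw [norm_mul, Complex.norm_real, Real.norm_eq_abs]
    gcongr
    · exact hM _
    · refine (norm_sub_le _ _).trans ?_
      rw [norm_mul, Complex.norm_exp, Complex.norm_exp]
      simp
      norm_num
  have hGi : Integrable (fun u => G u ζ) (volume.restrict (closedBall (0 : E3) L)) :=
    IntegrableOn.of_bound measure_closedBall_lt_top hGm.aestronglyMeasurable _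
      ((ae_restrict_mem measurableSet_closedBall).mono hGb)
  rw [hcol]
  have htr : ∫ u : E3, G u ζ *
      ∫ v : E3, (f v : ℂ) * f (v - u) * Complex.exp (-Complex.I * ⟪ζ, v⟫) =
      ∫ u in closedBall (0 : E3) L, G u ζ *
      ∫ v : E3, (f v : ℂ) * f (v - u) * Complex.exp (-Complex.I * ⟪ζ, v⟫) := by
    symm
    apply setIntegral_eq_integral_of_forall_compl_eq_zero
    intro u hu
    have hu' : L < ‖u‖ := by simpa using hu
    have : ∀ v, (f v : ℂ) * f (v - u) * Complex.exp (-Complex.I * ⟪ζ, v⟫) = 0 := by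
      intro v
      by_cases h1 : f v = 0
      · simp [h1]
      by_cases h2 : f (v - u) = 0
      · simp [h2]
      exfalso
      have h3 := hs _ h1
      have h4 := hs _ h2
      have h5 := norm_sub_le v (v - u)
      rw [sub_sub_cancel] at h5
      linarith
    simp only [this, integral_zero, mul_zero]
  rw [htr]
  simp only [conv_part f fhat hfhat]
  have hprod : Integrable (fun p : E3 × E3 => G p.1 ζ * (fhat (ζ - p.2) * fhat p.2) *
      Complex.exp (-Complex.I * ⟪p.2, p.1⟫))
      ((volume.restrict (closedBall (0 : E3) L)).prod volume) := by
    have hff : Integrable (fun ξ => fhat (ζ - ξ) * fhat ξ) :=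
      hfi.bdd_mul (c := F) (Continuous.aestronglyMeasurable (by fun_prop))
        (Filter.Eventually.of_forall fun ξ => hF _)
    refine (hGi.mul_prod hff).mul_bdd (c := 1) ?_ ?_
    · exact Continuous.aestronglyMeasurable (by fun_prop)
    · exact Filter.Eventually.of_forall fun p => (norm_e _).le
  have h1 : ∀ u, G u ζ * ∫ ξ : E3, fhat (ζ - ξ) * fhat ξ * Complex.exp (-Complex.I * ⟪ξ, u⟫) =
      ∫ ξ : E3, G u ζ * (fhat (ζ - ξ) * fhat ξ) * Complex.exp (-Complex.I * ⟪ξ, u⟫) := by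
    intro u
    rw [← integral_const_mul]
    congr 1; ext ξ; ring
  simp only [h1]
  rw [integral_integral_swap hprod, ← integral_const_mul]
  congr 1; ext ξ
  rw [hGhat, mul_assoc, mul_assoc, ← integral_mul_const]
  congr 2; ext u
  ring
end

section
/- Let λ ∈ ℝ, let b : [−1,1] → ℝ be continuous, let u ∈ ℝ³ with u ≠ 0, and let ζ ∈ ℝ³. Then the spherical weight integral reduces to a one-dimensional integral involving the Bessel function J₀: G(u,ζ) = 2π |u|^λ ∫₀^π b(cos θ) sin θ ( e^{(i/2)(1−cos θ) ζ·u} J₀(½ |u| sin θ |ζ^⊥|) − 1 ) dθ, where J₀(x) = (1/(2π)) ∫₀^{2π} cos(x sin φ) dφ and ζ^⊥ = ζ − ((ζ·u)/|u|²) u. -/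
open MeasureTheory Metric
open scoped RealInnerProductSpace

lemma lint_polar (f : ℝ × ℝ → ENNReal) (hf : Measurable f) :
    ∫⁻ p, f p = ∫⁻ t in Set.Ioo (-Real.pi) Real.pi, ∫⁻ r in Set.Ioi (0:ℝ),
      ENNReal.ofReal r * f (r * Real.cos t, r * Real.sin t) := by
  rw [← lintegral_comp_polarCoord_symm, polarCoord_target, Measure.volume_eq_prod,
    ← Measure.prod_restrict, lintegral_prod_symm]
  · simp [polarCoord_symm_apply]
  · simp only [polarCoord_symm_apply, smul_eq_mul]
    fun_prop

lemma lint_three (h : ℝ × ℝ × ℝ → ENNReal) (hm : Measurable h) :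
    ∫⁻ p, h p = ∫⁻ φ in Set.Ioo (-Real.pi) Real.pi, ∫⁻ θ in Set.Ioo (-Real.pi) Real.pi,
      ∫⁻ r in Set.Ioi (0:ℝ), ENNReal.ofReal r * (ENNReal.ofReal (r * Real.sin θ) *
        h (r * Real.cos θ, r * Real.sin θ * Real.cos φ, r * Real.sin θ * Real.sin φ)) := by
  have h1 : ∀ z φ : ℝ, ∫⁻ ρ in Set.Ioi (0:ℝ),
      ENNReal.ofReal ρ * h (z, ρ * Real.cos φ, ρ * Real.sin φ) =
      ∫⁻ ρ, ENNReal.ofReal ρ * h (z, ρ * Real.cos φ, ρ * Real.sin φ) := by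
    intro z φ
    rw [← lintegral_indicator measurableSet_Ioi]
    congr 1
    ext ρ
    by_cases hρ : 0 < ρ
    · simp [hρ]
    · simp [hρ, ENNReal.ofReal_of_nonpos (not_lt.1 hρ)]
  calc ∫⁻ p, h p = ∫⁻ z, ∫⁻ q, h (z, q) := by
        rw [Measure.volume_eq_prod, lintegral_prod _ hm.aemeasurable]
    _ = ∫⁻ z, ∫⁻ φ in Set.Ioo (-Real.pi) Real.pi, ∫⁻ ρ,
          ENNReal.ofReal ρ * h (z, ρ * Real.cos φ, ρ * Real.sin φ) := by
        congr 1
        ext z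
        rw [lint_polar _ (by fun_prop)]
        simp only [h1]
    _ = ∫⁻ φ in Set.Ioo (-Real.pi) Real.pi, ∫⁻ z, ∫⁻ ρ,
          ENNReal.ofReal ρ * h (z, ρ * Real.cos φ, ρ * Real.sin φ) := by
        apply lintegral_lintegral_swap
        apply Measurable.aemeasurable
        apply Measurable.lintegral_prod_right
        fun_prop
    _ = ∫⁻ φ in Set.Ioo (-Real.pi) Real.pi, ∫⁻ p : ℝ × ℝ,
          ENNReal.ofReal p.2 * h (p.1, p.2 * Real.cos φ, p.2 * Real.sin φ) := by
        congr 1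
        ext φ
        rw [Measure.volume_eq_prod, lintegral_prod _ (by fun_prop)]
    _ = _ := by
        congr 1
        ext φ
        rw [lint_polar _ (by fun_prop)]

lemma lint_r : ∫⁻ r in Set.Ioo (0:ℝ) 1, ENNReal.ofReal (r ^ 2) = ENNReal.ofReal (1/3) := by
  rw [← ofReal_integral_eq_lintegral_ofReal]
  · rw [← integral_Ioc_eq_integral_Ioo, ← intervalIntegral.integral_of_le zero_le_one]
    norm_num
  · exact ((continuous_pow 2).integrableOn_Icc (a := 0) (b := 1)).mono_set Set.Ioo_subset_Icc_self
  · exact Filter.Eventually.of_forall fun x => sq_nonneg x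

/-- Cartesian coordinates in an orthonormal basis. -/
noncomputable def cart (e : OrthonormalBasis (Fin 3) ℝ E3) (p : ℝ × ℝ × ℝ) : E3 :=
  p.1 • e 0 + p.2.1 • e 1 + p.2.2 • e 2

lemma cart_mp (e : OrthonormalBasis (Fin 3) ℝ E3) :
    MeasurePreserving (cart e) volume volume := by
  have h1 := (volume_preserving_piFinSuccAbove (fun _ : Fin 3 => ℝ) 0).symm
  have h2 := (volume_preserving_finTwoArrow ℝ).symm
  have h3 := (MeasurePreserving.id (volume : Measure ℝ)).prod h2
  have h4 := e.measurePreserving_repr_symm.comp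
    ((PiLp.volume_preserving_toLp (Fin 3)).comp (h1.comp h3))
  suffices h5 : cart e = (⇑e.repr.symm ∘ WithLp.toLp 2 ∘
      ⇑(MeasurableEquiv.piFinSuccAbove (fun _ : Fin 3 => ℝ) 0).symm ∘
        Prod.map id ⇑(MeasurableEquiv.finTwoArrow (α := ℝ)).symm) by
    rw [h5]
    exact h4
  funext p
  simp only [Function.comp, cart]
  rw [← e.sum_repr_symm, Fin.sum_univ_three]
  rfl

lemma cart_norm (e : OrthonormalBasis (Fin 3) ℝ E3) (θ φ : ℝ) :
    ‖cart e (Real.cos θ, Real.sin θ * Real.cos φ, Real.sin θ * Real.sin φ)‖ = 1 := by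
  have : ‖cart e (Real.cos θ, Real.sin θ * Real.cos φ, Real.sin θ * Real.sin φ)‖ ^ 2 = 1 := by
    rw [← e.sum_sq_norm_inner_right, Fin.sum_univ_three]
    have ho := e.inner_eq_ite
    simp only [cart, inner_add_right, inner_smul_right, ho]
    simp only [Real.norm_eq_abs, sq_abs]
    simp
    linear_combination Real.sin_sq_add_cos_sq θ + Real.sin θ ^ 2 * Real.sin_sq_add_cos_sq φ
  nlinarith [norm_nonneg (cart e (Real.cos θ, Real.sin θ * Real.cos φ, Real.sin θ * Real.sin φ))]

noncomputable def sph (e : OrthonormalBasis (Fin 3) ℝ E3) (p : ℝ × ℝ) : sphere (0 : E3) 1 :=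
  ⟨cart e (Real.cos p.1, Real.sin p.1 * Real.cos p.2, Real.sin p.1 * Real.sin p.2),
    by simpa using cart_norm e p.1 p.2⟩

lemma sph_cont (e : OrthonormalBasis (Fin 3) ℝ E3) : Continuous (sph e) := by
  unfold sph cart
  fun_prop

section
open scoped Pointwise

lemma cone_meas (s : Set (sphere (0 : E3) 1)) (hs : MeasurableSet s) :
    MeasurableSet (Set.Ioo (0:ℝ) 1 • (Subtype.val '' s) : Set E3) := by
  have h : (Set.Ioo (0:ℝ) 1 • (Subtype.val '' s) : Set E3) =
      (Subtype.val ∘ (homeomorphUnitSphereProd E3).symm) ''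
        (s ×ˢ Set.Iio ⟨1, Set.mem_Ioi.2 one_pos⟩) := by
    rw [← Set.image2_smul, Set.image2_image_right]
    have := Set.image_subtype_val_Ioi_Iio (a := (0:ℝ)) ⟨1, Set.mem_Ioi.2 one_pos⟩
    simp only at this
    rw [← this, Set.image2_image_left, Set.image2_swap, ← Set.image_prod]
    rfl
  rw [h]
  exact ((MeasurableEmbedding.subtype_coe (measurableSet_singleton _).compl).comp
      (Homeomorph.measurableEmbedding _)).measurableSet_image.2 (hs.prod measurableSet_Iio)

lemma cone_mem (s : Set (sphere (0 : E3) 1)) (σ : sphere (0 : E3) 1) (r : ℝ) (hr : 0 < r) :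
    r • (σ : E3) ∈ (Set.Ioo (0:ℝ) 1 • (Subtype.val '' s) : Set E3) ↔ r < 1 ∧ σ ∈ s := by
  constructor
  · rintro ⟨t, ht, _, ⟨τ, hτ, rfl⟩, h⟩
    simp only at h
    have h1 := congrArg norm h
    rw [norm_smul, norm_smul] at h1
    simp only [norm_eq_of_mem_sphere, Real.norm_eq_abs, abs_of_pos ht.1, abs_of_pos hr] at h1
    have h2 : t = r := by linarith
    subst h2
    have : τ = σ := Subtype.ext (smul_right_injective _ hr.ne' h)
    exact ⟨ht.2, this ▸ hτ⟩
  · rintro ⟨h1, h2⟩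
    exact ⟨r, ⟨hr, h1⟩, σ, ⟨σ, h2, rfl⟩, rfl⟩

lemma toSphere_eq (e : OrthonormalBasis (Fin 3) ℝ E3) :
    (volume : Measure E3).toSphere =
      Measure.map (sph e) (((volume.restrict (Set.Ioo (-Real.pi) Real.pi)).prod
        (volume.restrict (Set.Ioo (-Real.pi) Real.pi))).withDensity
          (fun p => ENNReal.ofReal (Real.sin p.1))) := by
  ext s hs
  rw [Measure.toSphere_apply' _ hs, Measure.map_apply (sph_cont e).measurable hs,
    withDensity_apply _ ((sph_cont e).measurable hs),
    ← lintegral_indicator ((sph_cont e).measurable hs)]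
  have hK := cone_meas s hs
  have hp : Measurable (sph e) := (sph_cont e).measurable
  rw [lintegral_prod_symm _ ((Measurable.indicator (by fun_prop) (hp hs)).aemeasurable)]
  rw [← lintegral_indicator_one hK, ← (cart_mp e).lintegral_comp (measurable_one.indicator hK),
    lint_three (fun p => (Set.Ioo (0:ℝ) 1 • (Subtype.val '' s) : Set E3).indicator 1 (cart e p))
      ((measurable_one.indicator hK).comp (cart_mp e).measurable)]
  have key : ∀ θ φ : ℝ, ∫⁻ r in Set.Ioi (0:ℝ), ENNReal.ofReal r * (ENNReal.ofReal (r * Real.sin θ) *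
        (Set.Ioo (0:ℝ) 1 • (Subtype.val '' s) : Set E3).indicator 1 
          (cart e (r * Real.cos θ, r * Real.sin θ * Real.cos φ, r * Real.sin θ * Real.sin φ)))
      = ENNReal.ofReal (1/3) *
        (sph e ⁻¹' s).indicator (fun p => ENNReal.ofReal (Real.sin p.1)) (θ, φ) := by
    intro θ φ
    rw [← lint_r, ← lintegral_mul_const _ (by fun_prop),
      ← lintegral_indicator measurableSet_Ioo, ← lintegral_indicator measurableSet_Ioi]
    congr 1
    ext r
    by_cases hr : 0 < r
    · have hc : cart e (r * Real.cos θ, r * Real.sin θ * Real.cos φ, r * Real.sin θ * Real.sin φ)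
          = r • (sph e (θ, φ) : E3) := by
        simp only [cart, sph, smul_add, smul_smul, mul_assoc]
      have := cone_mem s (sph e (θ, φ)) r hr
      rw [Set.indicator_of_mem (show r ∈ Set.Ioi (0:ℝ) from hr), hc]
      by_cases h1 : r < 1
      · rw [Set.indicator_of_mem (show r ∈ Set.Ioo (0:ℝ) 1 from ⟨hr, h1⟩)]
        by_cases h2 : sph e (θ, φ) ∈ s
        · rw [Set.indicator_of_mem (this.2 ⟨h1, h2⟩), Set.indicator_of_mem (by exact h2)]
          rw [Pi.one_apply, mul_one, ← ENNReal.ofReal_mul hr.le, ← ENNReal.ofReal_mul (sq_nonneg r)]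
          congr 1
          ring
        · rw [Set.indicator_of_notMem (fun h => h2 (this.1 h).2), Set.indicator_of_notMem (by exact h2)]
          simp
      · rw [Set.indicator_of_notMem (fun h => h1 (this.1 h).1), Set.indicator_of_notMem (by simp [h1])]
        simp
    · simp [hr]
  simp only [key]
  have h3 : ∀ φ : ℝ, Measurable fun θ : ℝ => (sph e ⁻¹' s).indicator (fun p => ENNReal.ofReal (Real.sin p.1)) (θ, φ) := by
    intro φ
    exact (Measurable.indicator (by fun_prop) (hp hs)).comp (by fun_prop : Measurable fun θ : ℝ => (θ, φ))
  simp_rw [lintegral_const_mul' _ _ ENNReal.ofReal_ne_top]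
  rw [← mul_assoc]
  have : (Module.finrank ℝ E3 : ENNReal) * ENNReal.ofReal (1/3) = 1 := by
    rw [finrank_euclideanSpace_fin, ← ENNReal.ofReal_natCast, ← ENNReal.ofReal_mul (by norm_num)]
    norm_num
  rw [this, one_mul]

end

lemma sphere_integral (e : OrthonormalBasis (Fin 3) ℝ E3) (f : sphere (0 : E3) 1 → ℂ)
    (hf : Continuous f) :
    ∫ σ, f σ ∂(volume : Measure E3).toSphere =
      ∫ θ in (0:ℝ)..Real.pi, (Real.sin θ : ℂ) * ∫ φ in (-Real.pi)..Real.pi, f (sph e (θ, φ)) := by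
  have hc := sph_cont e
  have hpi := Real.pi_pos
  rw [toSphere_eq e, integral_map hc.measurable.aemeasurable hf.aestronglyMeasurable,
    integral_withDensity_eq_integral_toReal_smul (by fun_prop) (by simp), integral_prod]
  · have h1 : ∀ θ : ℝ, ∫ φ in Set.Ioo (-Real.pi) Real.pi,
        (ENNReal.ofReal (Real.sin θ)).toReal • f (sph e (θ, φ)) =
        (ENNReal.ofReal (Real.sin θ)).toReal • ∫ φ in (-Real.pi)..Real.pi, f (sph e (θ, φ)) := by
      intro θ
      rw [integral_smul, ← integral_Ioc_eq_integral_Ioo,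
        ← intervalIntegral.integral_of_le (by linarith)]
    simp only [h1]
    rw [intervalIntegral.integral_of_le hpi.le, integral_Ioc_eq_integral_Ioo,
      setIntegral_eq_of_subset_of_forall_sdiff_eq_zero measurableSet_Ioo
        (Set.Ioo_subset_Ioo_left (by linarith : -Real.pi ≤ 0))]
    · apply setIntegral_congr_fun measurableSet_Ioo
      intro θ hθ
      simp only
      rw [ENNReal.toReal_ofReal (Real.sin_pos_of_mem_Ioo hθ).le, Complex.real_smul]
    · rintro θ ⟨h2, h3⟩
      have : θ ≤ 0 := by
        by_contra h
        exact h3 ⟨by linarith, h2.2⟩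
      rw [ENNReal.ofReal_of_nonpos (Real.sin_nonpos_of_nonpos_of_neg_pi_le this h2.1.le)]
      simp
  · rw [Measure.prod_restrict, ← Measure.volume_eq_prod]
    have h4 : Continuous fun z : ℝ × ℝ => (ENNReal.ofReal (Real.sin z.1)).toReal • f (sph e z) := by
      have : Continuous fun z : ℝ × ℝ => (ENNReal.ofReal (Real.sin z.1)).toReal := by
        simp only [ENNReal.toReal_ofReal']
        fun_prop
      fun_prop
    exact (h4.continuousOn.integrableOn_compact
      ((isCompact_Icc (a := -Real.pi) (b := Real.pi)).prod
        (isCompact_Icc (a := -Real.pi) (b := Real.pi)))).mono_set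
        (Set.prod_mono Set.Ioo_subset_Icc_self Set.Ioo_subset_Icc_self)

lemma bessel_aux (x z₁ z₂ R : ℝ) (hR : 0 ≤ R) (h : R ^ 2 = z₁ ^ 2 + z₂ ^ 2) :
    ∫ φ in (-Real.pi)..Real.pi,
      Complex.exp (-Complex.I * ((x * (z₁ * Real.cos φ + z₂ * Real.sin φ) : ℝ) : ℂ)) =
    ((∫ φ in (0:ℝ)..(2 * Real.pi), Real.cos (x * R * Real.sin φ) : ℝ) : ℂ) := by
  obtain ⟨a, ha1, ha2⟩ : ∃ a : ℝ, z₁ = R * Real.sin a ∧ z₂ = R * Real.cos a := by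
    have hRn : R = ‖(⟨z₂, z₁⟩ : ℂ)‖ := by
      rw [← sq_eq_sq₀ hR (norm_nonneg _), Complex.sq_norm, Complex.normSq_mk, h]
      ring
    refine ⟨Complex.arg ⟨z₂, z₁⟩, ?_, ?_⟩
    · rw [hRn, Complex.norm_mul_sin_arg]
    · rw [hRn, Complex.norm_mul_cos_arg]
  let g : ℝ → ℂ := fun φ => Complex.exp (-Complex.I * ((x * R * Real.sin φ : ℝ) : ℂ))
  have hper : Function.Periodic g (2 * Real.pi) := by
    intro φ
    simp only [g, Real.sin_add_two_pi]
  have hg : Continuous g := by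
    simp only [g]
    fun_prop
  have e1 : ∀ φ : ℝ, Complex.exp (-Complex.I * ((x * (z₁ * Real.cos φ + z₂ * Real.sin φ) : ℝ) : ℂ))
      = g (φ + a) := by
    intro φ
    simp only [g, Real.sin_add, ha1, ha2]
    congr 3
    ring
  simp only [e1]
  rw [intervalIntegral.integral_comp_add_right]
  have e2 := hper.intervalIntegral_add_eq (-Real.pi + a) 0
  have e3 := hper.intervalIntegral_add_eq 0 (-Real.pi)
  rw [show -Real.pi + a + 2 * Real.pi = Real.pi + a by ring] at e2
  rw [show -Real.pi + 2 * Real.pi = Real.pi by ring] at e3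
  have e4 : ∫ φ in (-Real.pi)..Real.pi, g (-φ) = ∫ φ in (-Real.pi)..Real.pi, g φ := by
    rw [intervalIntegral.integral_comp_neg, neg_neg]
  have hper' : Function.Periodic (fun φ => g (-φ)) (2 * Real.pi) := by
    intro φ
    simp only [g, neg_add, Real.sin_neg, ← sub_eq_add_neg, Real.sin_sub_two_pi]
  have e5 := hper'.intervalIntegral_add_eq 0 (-Real.pi)
  rw [show -Real.pi + 2 * Real.pi = Real.pi by ring] at e5
  have e6 : ((∫ φ in (0:ℝ)..(2 * Real.pi), Real.cos (x * R * Real.sin φ) : ℝ) : ℂ) =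
      ∫ φ in (0:ℝ)..(2 * Real.pi), (g φ + g (-φ)) / 2 := by
    rw [← intervalIntegral.integral_ofReal]
    congr 1
    ext φ
    simp only [g, Real.sin_neg]
    rw [Complex.ofReal_cos, Complex.cos, add_comm]
    congr 2 <;> congr 1 <;> push_cast <;> ring
  rw [e2, e6, intervalIntegral.integral_div, intervalIntegral.integral_add
    (hg.intervalIntegrable _ _) ((by fun_prop : Continuous fun φ => g (-φ)).intervalIntegrable _ _)]
  rw [zero_add] at e3 e5 ⊢
  rw [e5, e4, e3]
  ring

lemma exists_basis (u : E3) (hu : u ≠ 0) :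
    ∃ e : OrthonormalBasis (Fin 3) ℝ E3, u = ‖u‖ • e 0 := by
  have hn : ‖u‖ ≠ 0 := norm_ne_zero_iff.2 hu
  obtain ⟨e, he⟩ := Orthonormal.exists_orthonormalBasis_extension_of_card_eq (𝕜 := ℝ) (E := E3)
    (ι := Fin 3) (by simp) (v := fun _ => ‖u‖⁻¹ • u) (s := {0}) (by
      constructor
      · intro i
        simp [norm_smul, hn]
      · intro i j hij
        exact absurd (Subsingleton.elim i j) hij)
  refine ⟨e, ?_⟩
  rw [he 0 rfl, smul_smul, mul_inv_cancel₀ hn, one_smul]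

/-- The spherical weight integral reduces to a one-dimensional integral
involving the Bessel function `J₀`. -/
theorem weight_reduces_to_bessel_integral
    (lam : ℝ) (b : ℝ → ℝ) (hb : ContinuousOn b (Set.Icc (-1) 1))
    (u ζ : EuclideanSpace ℝ (Fin 3)) (hu : u ≠ 0)
    (G : ℂ)
    (hG : G =
      (‖u‖ ^ lam : ℝ) * ∫ σ : sphere (0 : EuclideanSpace ℝ (Fin 3)) 1,
        (b (⟪u, (σ : EuclideanSpace ℝ (Fin 3))⟫ / ‖u‖) : ℂ) *
          (Complex.exp (-(Complex.I / 2) * ‖u‖ * ⟪ζ, (σ : EuclideanSpace ℝ (Fin 3))⟫) *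
              Complex.exp ((Complex.I / 2) * ⟪ζ, u⟫) - 1)
        ∂(volume : Measure (EuclideanSpace ℝ (Fin 3))).toSphere)
    (J0 : ℝ → ℝ)
    (hJ0 : ∀ x : ℝ, J0 x = (2 * Real.pi)⁻¹ * ∫ φ in (0:ℝ)..(2 * Real.pi), Real.cos (x * Real.sin φ))
    (ζperp : EuclideanSpace ℝ (Fin 3))
    (hζperp : ζperp = ζ - (⟪ζ, u⟫ / ‖u‖ ^ 2) • u) :
    G = (2 * Real.pi : ℝ) * (‖u‖ ^ lam : ℝ) *
      ∫ θ in (0:ℝ)..Real.pi,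
        (b (Real.cos θ) : ℂ) * (Real.sin θ : ℝ) *
          (Complex.exp ((Complex.I / 2) * (1 - Real.cos θ) * ⟪ζ, u⟫) *
              (J0 ((1/2 : ℝ) * ‖u‖ * Real.sin θ * ‖ζperp‖) : ℝ) - 1) := by
  obtain ⟨e, he⟩ := exists_basis u hu
  have hn : ‖u‖ ≠ 0 := norm_ne_zero_iff.2 hu
  have ho := e.inner_eq_ite
  obtain ⟨z, hz⟩ : ∃ z : Fin 3 → ℝ, ∀ i, ⟪ζ, e i⟫ = z i := ⟨_, fun _ => rfl⟩
  have hzu : ⟪ζ, u⟫ = ‖u‖ * z 0 := by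
    conv_lhs => rw [he]
    rw [inner_smul_right, hz]
  have hζ : ζ = z 0 • e 0 + z 1 • e 1 + z 2 • e 2 := by
    rw [← e.sum_repr' ζ, Fin.sum_univ_three]
    simp only [real_inner_comm, hz]
  have hperp : ζperp = z 1 • e 1 + z 2 • e 2 := by
    have : (⟪ζ, u⟫ / ‖u‖ ^ 2) • u = z 0 • e 0 := by
      rw [hzu]
      conv_lhs => rw [he]
      rw [smul_smul, ← he]
      congr 1
      field_simp
    rw [hζperp, this]
    conv_lhs => rw [hζ]
    abel
  have hR : ‖ζperp‖ ^ 2 = z 1 ^ 2 + z 2 ^ 2 := by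
    rw [← e.sum_sq_norm_inner_right, Fin.sum_univ_three, hperp]
    simp only [inner_add_right, inner_smul_right, ho, Real.norm_eq_abs, sq_abs]
    simp
  have hue : ∀ i, ⟪u, e i⟫ = if i = 0 then ‖u‖ else 0 := by
    intro i
    conv_lhs => rw [he]
    rw [real_inner_smul_left, ho]
    simp [eq_comm]
  have hub : ∀ p : ℝ × ℝ, ⟪u, (sph e p : E3)⟫ / ‖u‖ = Real.cos p.1 := by
    intro p
    simp only [sph, cart, inner_add_right, inner_smul_right, hue]
    simp
    field_simp
  have hzs : ∀ p : ℝ × ℝ, ⟪ζ, (sph e p : E3)⟫ = z 0 * Real.cos p.1 +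
      Real.sin p.1 * (z 1 * Real.cos p.2 + z 2 * Real.sin p.2) := by
    intro p
    simp only [sph, cart, inner_add_right, inner_smul_right, hz]
    ring
  rw [hG, sphere_integral e]
  · rw [mul_comm ((2 * Real.pi : ℝ) : ℂ), mul_assoc]
    congr 1
    rw [← intervalIntegral.integral_const_mul]
    apply intervalIntegral.integral_congr
    intro θ _
    simp only
    have hB := bessel_aux (1 / 2 * ‖u‖ * Real.sin θ) (z 1) (z 2) ‖ζperp‖ (norm_nonneg _) hR
    have hJ : ((∫ φ in (0:ℝ)..(2 * Real.pi),
        Real.cos (1 / 2 * ‖u‖ * Real.sin θ * ‖ζperp‖ * Real.sin φ) : ℝ) : ℂ) =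
        2 * Real.pi * (J0 (1 / 2 * ‖u‖ * Real.sin θ * ‖ζperp‖) : ℝ) := by
      rw [hJ0]
      have := Real.pi_ne_zero
      rw [← Complex.ofReal_ofNat, ← Complex.ofReal_mul, ← Complex.ofReal_mul]
      congr 1
      field_simp
    rw [hJ] at hB
    have hi : ∀ φ : ℝ, (b (⟪u, (sph e (θ, φ) : E3)⟫ / ‖u‖) : ℂ) *
          (Complex.exp (-(Complex.I / 2) * ‖u‖ * ⟪ζ, (sph e (θ, φ) : E3)⟫) *
              Complex.exp ((Complex.I / 2) * ⟪ζ, u⟫) - 1) =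
        (b (Real.cos θ) : ℂ) * (Complex.exp ((Complex.I / 2) * (1 - Real.cos θ) * ⟪ζ, u⟫) *
          Complex.exp (-Complex.I * ((1 / 2 * ‖u‖ * Real.sin θ *
            (z 1 * Real.cos φ + z 2 * Real.sin φ) : ℝ) : ℂ)) - 1) := by
      intro φ
      rw [hub, hzs, ← Complex.exp_add, ← Complex.exp_add, hzu]
      congr 3
      push_cast
      ring
    simp only [hi]
    rw [intervalIntegral.integral_const_mul, intervalIntegral.integral_sub,
      intervalIntegral.integral_const_mul, hB, intervalIntegral.integral_const]
    · simp only [Complex.real_smul]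
      push_cast
      ring
    · apply Continuous.intervalIntegrable
      fun_prop
    · simp
  · have hbc : Continuous fun σ : sphere (0 : E3) 1 => b (⟪u, (σ : E3)⟫ / ‖u‖) := by
      apply hb.comp_continuous (by fun_prop)
      intro σ
      have := abs_real_inner_div_norm_mul_norm_le_one u (σ : E3)
      rw [norm_eq_of_mem_sphere, mul_one] at this
      exact abs_le.1 this
    have hin : ∀ v : E3, Continuous fun σ : sphere (0 : E3) 1 => ((⟪v, (σ : E3)⟫ : ℝ) : ℂ) := by
      intro v
      fun_prop
    have hbc' := Complex.continuous_ofReal.comp hbc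
    have hin' := hin ζ
    refine Continuous.mul hbc' (Continuous.sub (Continuous.mul ?_ continuous_const) continuous_const)
    exact Complex.continuous_exp.comp (continuous_const.mul hin')
end

section
/- Let λ ≥ 0 and let f : ℝ³ → ℝ be a Schwartz function. Define the Fokker-Planck-Landau collision operator Q_L(f,f)(v) = ∇_v · ( ∫_{ℝ³} |u|^{λ+2} (I − (u ⊗ u)/|u|²) ( f(v*) ∇_v f(v) − f(v) (∇f)(v*) ) dv* ), where u = v − v*. Then for every ζ ∈ ℝ³, its Fourier transform equals the weighted convolution (2π)^{−3/2} ∫_{ℝ³} Q_L(f,f)(v) e^{−i ζ·v} dv = ∫_{ℝ³} 4 |u|^λ ( i (u·ζ) − ¼ |u|² |ζ^⊥|² ) · ( (2π)^{−3/2} ∫_{ℝ³} f(v) f(v−u) e^{−i ζ·v} dv ) du, where ζ^⊥ = ζ − ((ζ·u)/|u|²) u. -/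
open MeasureTheory Metric
open scoped RealInnerProductSpace

namespace LandauAux

abbrev E3 := EuclideanSpace ℝ (Fin 3)

/-- Measurable functions of polynomial growth. -/
def Gr (a : E3 → ℝ) : Prop :=
  Measurable a ∧ ∃ (C : ℝ) (k : ℕ), 0 ≤ C ∧ ∀ u, |a u| ≤ C * (1 + ‖u‖) ^ k

lemma Gr.add {a b : E3 → ℝ} (ha : Gr a) (hb : Gr b) : Gr (fun u => a u + b u) := by
  obtain ⟨ma, C, k, hC, h⟩ := ha
  obtain ⟨mb, D, l, hD, h'⟩ := hb
  refine ⟨ma.add mb, C + D, k + l, by positivity, fun u => ?_⟩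
  have h1 : (1:ℝ) ≤ 1 + ‖u‖ := by linarith [norm_nonneg u]
  have e1 : (1 + ‖u‖) ^ k ≤ (1 + ‖u‖) ^ (k + l) := pow_le_pow_right₀ h1 (by omega)
  have e2 : (1 + ‖u‖) ^ l ≤ (1 + ‖u‖) ^ (k + l) := pow_le_pow_right₀ h1 (by omega)
  calc |a u + b u| ≤ |a u| + |b u| := abs_add_le _ _
    _ ≤ C * (1 + ‖u‖) ^ k + D * (1 + ‖u‖) ^ l := add_le_add (h u) (h' u)
    _ ≤ C * (1 + ‖u‖) ^ (k+l) + D * (1 + ‖u‖) ^ (k+l) := by gcongr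
    _ = _ := by ring

lemma Gr.mul {a b : E3 → ℝ} (ha : Gr a) (hb : Gr b) : Gr (fun u => a u * b u) := by
  obtain ⟨ma, C, k, hC, h⟩ := ha
  obtain ⟨mb, D, l, hD, h'⟩ := hb
  refine ⟨ma.mul mb, C * D, k + l, by positivity, fun u => ?_⟩
  calc |a u * b u| = |a u| * |b u| := abs_mul _ _
    _ ≤ (C * (1 + ‖u‖) ^ k) * (D * (1 + ‖u‖) ^ l) := by
        have := h u; have := h' u; gcongr
    _ = _ := by ring

lemma Gr.const (c : ℝ) : Gr (fun _ => c) :=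
  ⟨measurable_const, |c|, 0, abs_nonneg c, fun u => by simp⟩

lemma Gr.sub {a b : E3 → ℝ} (ha : Gr a) (hb : Gr b) : Gr (fun u => a u - b u) := by
  have := ha.add ((Gr.const (-1)).mul hb)
  convert this using 2
  ring

lemma Gr.sum {a : Fin 3 → E3 → ℝ} (ha : ∀ i, Gr (a i)) : Gr (fun u => ∑ i, a i u) := by
  simp only [Fin.sum_univ_three]
  exact ((ha 0).add (ha 1)).add (ha 2)

lemma Gr.coord (i : Fin 3) : Gr (fun u => u i) := by
  refine ⟨by fun_prop, 1, 1, zero_le_one, fun u => ?_⟩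
  have := PiLp.norm_apply_le u i
  rw [Real.norm_eq_abs] at this
  linarith

lemma Gr.inner (ζ : E3) : Gr (fun u => ⟪u, ζ⟫) := by
  refine ⟨by fun_prop, ‖ζ‖, 1, norm_nonneg _, fun u => ?_⟩
  have := abs_real_inner_le_norm u ζ
  nlinarith [norm_nonneg ζ, norm_nonneg u]

lemma Gr.rpow (r : ℝ) (hr : 0 ≤ r) : Gr (fun u => ‖u‖ ^ r) := by
  refine ⟨by fun_prop, 1, ⌈r⌉₊, zero_le_one, fun u => ?_⟩
  rw [abs_of_nonneg (by positivity), one_mul, ← Real.rpow_natCast]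
  calc ‖u‖ ^ r ≤ (1 + ‖u‖) ^ r := by gcongr; linarith
    _ ≤ _ := Real.rpow_le_rpow_of_exponent_le (by linarith [norm_nonneg u]) (Nat.le_ceil r)

lemma Gr.quot (j : Fin 3) : Gr (fun u => u j * u j / ‖u‖ ^ 2) := by
  refine ⟨by fun_prop, 1, 0, zero_le_one, fun u => ?_⟩
  have := PiLp.norm_apply_le u j
  rw [Real.norm_eq_abs] at this
  rw [abs_of_nonneg (by positivity [mul_self_nonneg (u j)])]
  simp only [pow_zero, mul_one]
  apply div_le_one_of_le₀ _ (by positivity)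
  rw [← abs_mul_abs_self]
  nlinarith [abs_nonneg (u j)]

section
variable {V : Type*} [NormedAddCommGroup V] [NormedSpace ℝ V]

lemma decay (q : SchwartzMap E3 V) (N : ℕ) :
    ∃ C : ℝ, 0 ≤ C ∧ ∀ x, ‖q x‖ ≤ C * ((1 + ‖x‖) ^ N)⁻¹ := by
  refine ⟨2 ^ N * ((Finset.Iic (N, 0)).sup fun m => SchwartzMap.seminorm ℝ m.1 m.2) q,
    by positivity, fun x => ?_⟩
  have := SchwartzMap.one_add_le_sup_seminorm_apply (𝕜 := ℝ) (m := (N, 0)) (k := N) (n := 0)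
    le_rfl le_rfl q x
  rw [norm_iteratedFDeriv_zero] at this
  rw [← div_eq_mul_inv, le_div_iff₀ (by positivity), mul_comm]
  exact this

lemma key {a : E3 → ℝ} (ha : Gr a) (q : SchwartzMap E3 V) :
    ∃ (C : ℝ) (N : ℕ), 0 ≤ C ∧ ∀ v u, |a u| * ‖q (v - u)‖ ≤
      C * (1 + ‖v‖) ^ N * ((1 + ‖u‖) ^ 4)⁻¹ := by
  obtain ⟨ma, C, k, hC, h⟩ := ha
  obtain ⟨D, hD, h'⟩ := decay q (k + 4)
  refine ⟨C * D, k + 4, by positivity, fun v u => ?_⟩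
  have h1 : 1 + ‖u‖ ≤ (1 + ‖v‖) * (1 + ‖v - u‖) := by
    have : ‖u‖ ≤ ‖v‖ + ‖v - u‖ := by
      have := norm_sub_le v (v - u)
      simpa using this
    nlinarith [norm_nonneg v, norm_nonneg (v - u)]
  have h2 : (1 + ‖u‖) ^ (k + 4) ≤ (1 + ‖v‖) ^ (k+4) * (1 + ‖v - u‖) ^ (k+4) := by
    rw [← mul_pow]; gcongr
  calc |a u| * ‖q (v - u)‖ ≤ (C * (1 + ‖u‖) ^ k) * (D * ((1 + ‖v - u‖) ^ (k+4))⁻¹) := by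
        have := h u; have := h' (v - u); gcongr
    _ ≤ (C * (1 + ‖u‖) ^ k) * (D * ((1 + ‖v‖) ^ (k+4) * ((1 + ‖u‖) ^ (k+4))⁻¹)) := by
        gcongr
        rw [← div_eq_mul_inv, inv_eq_one_div, div_le_div_iff₀ (by positivity) (by positivity)]
        linarith
    _ = _ := by
        have : (1 + ‖u‖) ≠ 0 := by positivity
        field_simp
        ring

lemma int4 : Integrable (fun u : E3 => ((1 + ‖u‖) ^ 4)⁻¹) := by
  have := integrable_one_add_norm (E := E3) (μ := volume) (r := 4) (by simp; norm_num)
  refine this.congr (Filter.Eventually.of_forall fun u => ?_)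
  simp only
  rw [Real.rpow_neg (by positivity)]
  norm_cast

lemma int_conv {a : E3 → ℝ} (ha : Gr a) (q : SchwartzMap E3 V) (v : E3) :
    Integrable (fun u => a u • q (v - u)) := by
  obtain ⟨C, N, hC, h⟩ := key ha q
  refine (int4.const_mul (C * (1 + ‖v‖) ^ N)).mono' ?_ (Filter.Eventually.of_forall fun u => ?_)
  · exact ha.1.aestronglyMeasurable.smul
      (q.continuous.comp (continuous_const.sub continuous_id)).aestronglyMeasurable
  · rw [norm_smul, Real.norm_eq_abs]; exact h v u

end

/-- Convolution. -/
noncomputable def cv (a : E3 → ℝ) (q : SchwartzMap E3 ℝ) (v : E3) : ℝ := ∫ u, a u * q (v - u)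

noncomputable def dd (i : Fin 3) (q : SchwartzMap E3 ℝ) : SchwartzMap E3 ℝ :=
  LineDeriv.lineDerivOp (EuclideanSpace.single i (1:ℝ) : E3) q

lemma dd_apply (i : Fin 3) (q : SchwartzMap E3 ℝ) (v : E3) :
    dd i q v = fderiv ℝ q v (EuclideanSpace.single i 1) :=
  SchwartzMap.lineDerivOp_apply_eq_fderiv _ _ _

lemma cv_hasFDerivAt {a : E3 → ℝ} (ha : Gr a) (q : SchwartzMap E3 ℝ) (v : E3) :
    HasFDerivAt (cv a q) (∫ u, a u • SchwartzMap.fderivCLM ℝ E3 ℝ q (v - u)) v := by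
  obtain ⟨C, N, hC, h⟩ := key ha (SchwartzMap.fderivCLM ℝ E3 ℝ q)
  unfold cv
  refine hasFDerivAt_integral_of_dominated_of_fderiv_le (s := ball v 1)
    (bound := fun u => (C * (2 + ‖v‖) ^ N) * ((1 + ‖u‖) ^ 4)⁻¹)
    (F' := fun v u => a u • SchwartzMap.fderivCLM ℝ E3 ℝ q (v - u))
    (ball_mem_nhds v one_pos) ?_ ?_ ?_ ?_ ?_ ?_
  · exact Filter.Eventually.of_forall fun x => (int_conv ha q x).1
  · exact int_conv ha q v
  · exact (int_conv ha _ v).1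
  · refine Filter.Eventually.of_forall fun u x hx => ?_
    rw [norm_smul, Real.norm_eq_abs]
    refine (h x u).trans ?_
    have : ‖x‖ ≤ 1 + ‖v‖ := by
      have h1 := norm_add_le (x - v) v
      rw [mem_ball, dist_eq_norm] at hx
      simp at h1; linarith
    have h3 : 1 + ‖x‖ ≤ 2 + ‖v‖ := by linarith
    gcongr
  · exact int4.const_mul _
  · refine Filter.Eventually.of_forall fun u x hx => ?_
    have h1 : HasFDerivAt (fun x => q (x - u)) (fderiv ℝ q (x - u)) x := by
      have := (q.differentiableAt (x := x - u)).hasFDerivAt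
      exact this.comp x ((hasFDerivAt_id x).sub_const u)
    simpa using h1.const_mul (a u)

lemma cv_hasFDerivAt' {a : E3 → ℝ} (ha : Gr a) (q : SchwartzMap E3 ℝ) (v : E3) :
    ∃ L : E3 →L[ℝ] ℝ, HasFDerivAt (cv a q) L v ∧
      ∀ i, L (EuclideanSpace.single i 1) = cv a (dd i q) v := by
  refine ⟨_, cv_hasFDerivAt ha q v, fun i => ?_⟩
  rw [ContinuousLinearMap.integral_apply (int_conv ha _ v)]
  simp [cv, dd_apply]

lemma int_prod {a : E3 → ℝ} (ha : Gr a) (p q : SchwartzMap E3 ℝ) (φ : E3 → ℂ)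
    (hφ : Continuous φ) (hφ1 : ∀ v, ‖φ v‖ ≤ 1) :
    Integrable (fun z : E3 × E3 => ((p z.1 * (a z.2 * q (z.1 - z.2)) : ℝ) : ℂ) * φ z.1)
      (volume.prod volume) := by
  obtain ⟨C, N, hC, h⟩ := key ha q
  obtain ⟨D, hD, h'⟩ := decay p (N + 4)
  refine ((int4.const_mul (C * D)).mul_prod int4).mono' ?_ (Filter.Eventually.of_forall ?_)
  · apply Measurable.aestronglyMeasurable
    have := ha.1
    have := p.continuous.measurable
    have := q.continuous.measurable
    have := hφ.measurable
    fun_prop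
  · rintro ⟨v, u⟩
    simp only [norm_mul, Complex.norm_real, Real.norm_eq_abs]
    have e1 := h v u
    have e2 := h' v
    simp only [Real.norm_eq_abs] at e1 e2
    calc |p v| * (|a u| * |q (v - u)|) * ‖φ v‖
        ≤ (D * ((1 + ‖v‖) ^ (N+4))⁻¹) * (C * (1 + ‖v‖) ^ N * ((1 + ‖u‖) ^ 4)⁻¹) * 1 := by
          gcongr; exact hφ1 v
      _ = _ := by
        have : (1 + ‖v‖) ≠ 0 := by positivity
        field_simp
        ring

noncomputable def ph (ζ v : E3) : ℂ := Complex.exp (-Complex.I * ⟪ζ, v⟫)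

lemma ph_cont (ζ : E3) : Continuous (ph ζ) := by
  unfold ph; fun_prop

lemma ph_norm (ζ v : E3) : ‖ph ζ v‖ ≤ 1 := by
  unfold ph
  rw [Complex.norm_exp]
  simp

noncomputable def T (ζ : E3) (a : E3 → ℝ) (p q : SchwartzMap E3 ℝ) : ℂ :=
  ∫ v, ((p v * cv a q v : ℝ) : ℂ) * ph ζ v

lemma inner_int (ζ : E3) (a : E3 → ℝ) (p q : SchwartzMap E3 ℝ) (v : E3) :
    ∫ u, ((p v * (a u * q (v - u)) : ℝ) : ℂ) * ph ζ v = ((p v * cv a q v : ℝ) : ℂ) * ph ζ v := by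
  rw [integral_mul_const, integral_complex_ofReal, integral_const_mul]
  rfl

lemma int_T (ζ : E3) {a : E3 → ℝ} (ha : Gr a) (p q : SchwartzMap E3 ℝ) :
    Integrable (fun v => ((p v * cv a q v : ℝ) : ℂ) * ph ζ v) := by
  have := (int_prod ha p q (ph ζ) (ph_cont ζ) (ph_norm ζ)).integral_prod_left
  simpa only [inner_int] using this

noncomputable def Gh (ζ : E3) (p q : SchwartzMap E3 ℝ) (u : E3) : ℂ :=
  ∫ v, ((p v * q (v - u) : ℝ) : ℂ) * ph ζ v

lemma inner_int' (ζ : E3) (a : E3 → ℝ) (p q : SchwartzMap E3 ℝ) (u : E3) :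
    ∫ v, ((p v * (a u * q (v - u)) : ℝ) : ℂ) * ph ζ v = (a u : ℂ) * Gh ζ p q u := by
  unfold Gh
  rw [← integral_const_mul]
  congr 1
  ext v
  push_cast
  ring

lemma int_Gh (ζ : E3) {a : E3 → ℝ} (ha : Gr a) (p q : SchwartzMap E3 ℝ) :
    Integrable (fun u => (a u : ℂ) * Gh ζ p q u) := by
  have := (int_prod ha p q (ph ζ) (ph_cont ζ) (ph_norm ζ)).integral_prod_right
  simpa only [inner_int'] using this

lemma T_fubini (ζ : E3) {a : E3 → ℝ} (ha : Gr a) (p q : SchwartzMap E3 ℝ) :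
    T ζ a p q = ∫ u, (a u : ℂ) * Gh ζ p q u := by
  have := integral_integral_swap (f := fun v u => ((p v * (a u * q (v - u)) : ℝ) : ℂ) * ph ζ v)
    (int_prod ha p q (ph ζ) (ph_cont ζ) (ph_norm ζ))
  simp only [inner_int', inner_int] at this
  exact this

lemma pcv_line {a : E3 → ℝ} (ha : Gr a) (p q : SchwartzMap E3 ℝ) (v : E3) :
    ∃ L : E3 →L[ℝ] ℝ, HasFDerivAt (fun v => p v * cv a q v) L v ∧
      ∀ i, L (EuclideanSpace.single i 1) = dd i p v * cv a q v + p v * cv a (dd i q) v := by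
  obtain ⟨L, hL, hL'⟩ := cv_hasFDerivAt' ha q v
  refine ⟨_, (p.differentiableAt (x := v)).hasFDerivAt.mul hL, fun i => ?_⟩
  simp [hL', dd_apply]
  ring

lemma ph_line (ζ : E3) (i : Fin 3) (v : E3) :
    HasLineDerivAt ℝ (ph ζ) (-Complex.I * (ζ i : ℂ) * ph ζ v) v (EuclideanSpace.single i 1) := by
  unfold HasLineDerivAt ph
  have h1 : HasDerivAt (fun t : ℝ => ⟪ζ, v + t • (EuclideanSpace.single i 1 : E3)⟫) (ζ i) 0 := by
    simp only [inner_add_right, inner_smul_right, EuclideanSpace.inner_single_right]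
    simpa using ((hasDerivAt_id (0:ℝ)).mul_const (ζ i)).const_add (⟪ζ, v⟫)
  have h2 := (h1.ofReal_comp.const_mul (-Complex.I)).cexp
  rw [zero_smul, add_zero, mul_comm] at h2
  exact h2

lemma T_ibp (ζ : E3) {a : E3 → ℝ} (ha : Gr a) (p q : SchwartzMap E3 ℝ) (i : Fin 3) :
    T ζ a (dd i p) q + T ζ a p (dd i q) = Complex.I * (ζ i : ℂ) * T ζ a p q := by
  have hI := (int_T ζ ha (dd i p) q).add (int_T ζ ha p (dd i q))
  have e : ∀ v, ((dd i p v * cv a q v : ℝ) : ℂ) * ph ζ v +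
      ((p v * cv a (dd i q) v : ℝ) : ℂ) * ph ζ v =
      ((dd i p v * cv a q v + p v * cv a (dd i q) v : ℝ) : ℂ) * ph ζ v := by
    intro v; push_cast; ring
  have key := integral_bilinear_hasLineDerivAt_right_eq_neg_left_of_integrable (μ := volume)
    (f := fun v => ((p v * cv a q v : ℝ) : ℂ)) (g := ph ζ)
    (f' := fun v => ((dd i p v * cv a q v + p v * cv a (dd i q) v : ℝ) : ℂ))
    (g' := fun v => (-Complex.I * (ζ i : ℂ) * ph ζ v)) (v := EuclideanSpace.single i 1)
    (B := ContinuousLinearMap.mul ℝ ℂ) ?_ ?_ ?_ ?_ ?_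
  · simp only [ContinuousLinearMap.mul_apply'] at key
    unfold T
    rw [← integral_add (int_T ζ ha (dd i p) q) (int_T ζ ha p (dd i q))]
    simp only [e]
    rw [← neg_eq_iff_eq_neg] at key
    rw [← key, ← integral_const_mul, ← integral_neg]
    congr 1
    ext v
    ring
  · simp only [ContinuousLinearMap.mul_apply']
    refine hI.congr (Filter.Eventually.of_forall fun v => ?_)
    exact e v
  · simp only [ContinuousLinearMap.mul_apply']
    refine ((int_T ζ ha p q).const_mul (-Complex.I * (ζ i : ℂ))).congr
      (Filter.Eventually.of_forall fun v => ?_)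
    simp only
    ring
  · exact int_T ζ ha p q
  · intro v _
    obtain ⟨L, hL, hL'⟩ := pcv_line ha p q v
    have := hL.hasLineDerivAt (EuclideanSpace.single i 1)
    rw [hL'] at this
    exact HasDerivAt.ofReal_comp this
  · intro v _
    exact ph_line ζ i v

lemma cv_add {a b : E3 → ℝ} (ha : Gr a) (hb : Gr b) (q : SchwartzMap E3 ℝ) (v : E3) :
    cv (fun u => a u + b u) q v = cv a q v + cv b q v := by
  unfold cv
  have := integral_add (int_conv ha q v) (int_conv hb q v)
  simp only [smul_eq_mul] at this
  rw [← this]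
  simp only [add_mul]

lemma T_add (ζ : E3) {a b : E3 → ℝ} (ha : Gr a) (hb : Gr b) (p q : SchwartzMap E3 ℝ) :
    T ζ (fun u => a u + b u) p q = T ζ a p q + T ζ b p q := by
  unfold T
  rw [← integral_add (int_T ζ ha p q) (int_T ζ hb p q)]
  congr 1
  ext v
  rw [cv_add ha hb]
  push_cast
  ring

lemma T_smul (ζ : E3) (c : ℝ) (a : E3 → ℝ) (p q : SchwartzMap E3 ℝ) :
    T ζ (fun u => c * a u) p q = c * T ζ a p q := by
  unfold T
  rw [← integral_const_mul]
  congr 1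
  ext v
  have : cv (fun u => c * a u) q v = c * cv a q v := by
    unfold cv
    rw [← integral_const_mul]
    simp only [mul_assoc]
  rw [this]
  push_cast
  ring

lemma T_sum (ζ : E3) {a : Fin 3 → E3 → ℝ} (ha : ∀ i, Gr (a i)) (p q : SchwartzMap E3 ℝ) :
    T ζ (fun u => ∑ i, a i u) p q = ∑ i, T ζ (a i) p q := by
  simp only [Fin.sum_univ_three]
  rw [T_add ζ ((ha 0).add (ha 1)) (ha 2), T_add ζ (ha 0) (ha 1)]

/-- integration by parts in `u`. -/
lemma cv_ibp {b b' : E3 → ℝ} (hb : Gr b) (hb' : Gr b') (j : Fin 3)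
    (h : ∀ u, HasLineDerivAt ℝ b (b' u) u (EuclideanSpace.single j 1))
    (q : SchwartzMap E3 ℝ) (v : E3) : cv b (dd j q) v = cv b' q v := by
  have key := integral_bilinear_hasLineDerivAt_right_eq_neg_left_of_integrable (μ := volume)
    (f := b) (g := fun u => q (v - u))
    (f' := b')
    (g' := fun u => - dd j q (v - u)) (v := EuclideanSpace.single j 1)
    (B := ContinuousLinearMap.mul ℝ ℝ) ?_ ?_ ?_ ?_ ?_
  · simp only [ContinuousLinearMap.mul_apply', mul_neg, integral_neg, neg_inj] at key
    exact key
  · exact int_conv hb' q v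
  · simpa using (int_conv hb (dd j q) v).neg
  · exact int_conv hb q v
  · exact fun u _ => h u
  · intro u _
    have h1 : HasFDerivAt (fun u => q (v - u)) _ u :=
      (q.differentiableAt (x := v - u)).hasFDerivAt.comp u ((hasFDerivAt_id u).const_sub v)
    have := h1.hasLineDerivAt (EuclideanSpace.single j 1)
    simpa [dd_apply] using this

lemma T_ibp_u (ζ : E3) {b b' : E3 → ℝ} (hb : Gr b) (hb' : Gr b') (j : Fin 3)
    (h : ∀ u, HasLineDerivAt ℝ b (b' u) u (EuclideanSpace.single j 1))
    (p q : SchwartzMap E3 ℝ) : T ζ b p (dd j q) = T ζ b' p q := by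
  unfold T
  simp only [cv_ibp hb hb' j h]

noncomputable def aa (lam : ℝ) (i j : Fin 3) (u : E3) : ℝ :=
  (if i = j then 1 else 0) * ‖u‖ ^ (lam + 2) - ‖u‖ ^ lam * (u i * u j)

lemma aa_gr {lam : ℝ} (hlam : 0 ≤ lam) (i j : Fin 3) : Gr (aa lam i j) :=
  ((Gr.const _).mul (Gr.rpow _ (by linarith))).sub
    ((Gr.rpow _ hlam).mul ((Gr.coord i).mul (Gr.coord j)))

noncomputable def bb (lam : ℝ) (ζ : E3) (j : Fin 3) (u : E3) : ℝ :=
  ‖u‖ ^ (lam + 2) * ζ j - ‖u‖ ^ lam * (⟪u, ζ⟫ * u j)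

lemma bb_gr {lam : ℝ} (hlam : 0 ≤ lam) (ζ : E3) (j : Fin 3) : Gr (bb lam ζ j) :=
  ((Gr.rpow _ (by linarith)).mul (Gr.const _)).sub
    ((Gr.rpow _ hlam).mul ((Gr.inner ζ).mul (Gr.coord j)))

lemma inner3 (u w : E3) : ⟪u, w⟫ = u 0 * w 0 + u 1 * w 1 + u 2 * w 2 := by
  simp [PiLp.inner_apply, Fin.sum_univ_three]
  ring

lemma normsq3 (u : E3) : ‖u‖ ^ 2 = u 0 * u 0 + u 1 * u 1 + u 2 * u 2 := by
  rw [← real_inner_self_eq_norm_sq, inner3]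

lemma bb_eq (lam : ℝ) (ζ : E3) (j : Fin 3) :
    bb lam ζ j = fun u => ∑ i, ζ i * aa lam i j u := by
  ext u
  simp only [bb, aa, inner3, Fin.sum_univ_three]
  fin_cases j <;> simp <;> ring

noncomputable def bd (lam : ℝ) (ζ : E3) (j : Fin 3) (u : E3) : ℝ :=
  ((lam + 2) * ζ j) * (‖u‖ ^ lam * u j) - lam * (‖u‖ ^ lam * (⟪u, ζ⟫ * (u j * u j / ‖u‖ ^ 2)))
    - ζ j * (‖u‖ ^ lam * u j) - ‖u‖ ^ lam * ⟪u, ζ⟫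

lemma bd_gr {lam : ℝ} (hlam : 0 ≤ lam) (ζ : E3) (j : Fin 3) : Gr (bd lam ζ j) :=
  ((((Gr.const _).mul ((Gr.rpow _ hlam).mul (Gr.coord j))).sub
    ((Gr.const _).mul ((Gr.rpow _ hlam).mul ((Gr.inner ζ).mul (Gr.quot j))))).sub
    ((Gr.const _).mul ((Gr.rpow _ hlam).mul (Gr.coord j)))).sub
    ((Gr.rpow _ hlam).mul (Gr.inner ζ))

lemma bd_sum (lam : ℝ) (ζ : E3) (u : E3) :
    ∑ j, bd lam ζ j u = -2 * (‖u‖ ^ lam * ⟪u, ζ⟫) := by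
  by_cases hu : u = 0
  · simp [hu, bd]
  have h0 : ‖u‖ ^ 2 ≠ 0 := by simpa using hu
  have e : u 0 * u 0 / ‖u‖ ^ 2 + u 1 * u 1 / ‖u‖ ^ 2 + u 2 * u 2 / ‖u‖ ^ 2 = 1 := by
    rw [← add_div, ← add_div, ← normsq3, div_self h0]
  have e2 : u 2 * u 2 / ‖u‖ ^ 2 = 1 - u 0 * u 0 / ‖u‖ ^ 2 - u 1 * u 1 / ‖u‖ ^ 2 := by linarith
  simp only [Fin.sum_univ_three, bd, e2]
  simp only [inner3]
  ring

lemma bb_line {lam : ℝ} (hlam : 0 ≤ lam) (ζ : E3) (j : Fin 3) (u : E3) :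
    HasLineDerivAt ℝ (bb lam ζ j) (bd lam ζ j u) u (EuclideanSpace.single j 1) := by
  by_cases hu : u = 0
  · subst hu
    have h1 : bd lam ζ j 0 = 0 := by simp [bd]
    have h2 : (fun t : ℝ => bb lam ζ j (0 + t • EuclideanSpace.single j 1)) = fun _ => 0 := by
      ext t
      have : lam + 2 ≠ 0 := by linarith
      by_cases ht : t = 0
      · simp [bb, ht, this]
      have ht' : 0 < |t| := abs_pos.mpr ht
      simp [bb, norm_smul, inner_smul_left, EuclideanSpace.inner_single_left]
      rw [Real.rpow_add ht', Real.rpow_two, sq_abs]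
      ring
    unfold HasLineDerivAt
    rw [h1, h2]
    exact hasDerivAt_const _ _
  have h0 : 0 < ‖u‖ := norm_pos_iff.mpr hu
  set e : E3 := EuclideanSpace.single j 1 with he
  have hline : HasDerivAt (fun t : ℝ => u + t • e) e 0 := by
    simpa using ((hasDerivAt_id (0:ℝ)).smul_const e).const_add u
  have hsq : HasDerivAt (fun t : ℝ => ‖u + t • e‖ ^ 2) (2 * u j) 0 := by
    have := hline.norm_sq
    simpa [he, EuclideanSpace.inner_single_right] using this
  have hr : ∀ r : ℝ, HasDerivAt (fun t : ℝ => ‖u + t • e‖ ^ r) (r * ‖u‖ ^ r * u j / ‖u‖ ^ 2) 0 := by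
    intro r
    have h3 := hsq.rpow_const (p := r / 2) (Or.inl (by simpa using hu))
    have h4 : (fun t : ℝ => ‖u + t • e‖ ^ r) = fun t : ℝ => (‖u + t • e‖ ^ 2) ^ (r / 2) := by
      ext t
      rw [← Real.rpow_natCast, ← Real.rpow_mul (norm_nonneg _)]
      congr 1
      push_cast
      ring
    rw [h4]
    convert h3 using 1
    simp only [zero_smul, add_zero]
    rw [Real.rpow_sub_one (by positivity), ← Real.rpow_natCast, ← Real.rpow_mul (norm_nonneg _)]
    have : ((2:ℕ):ℝ) * (r / 2) = r := by push_cast; ring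
    rw [this]
    ring
  have hin : HasDerivAt (fun t : ℝ => ⟪u + t • e, ζ⟫) (ζ j) 0 := by
    have := hline.inner ℝ (hasDerivAt_const (0:ℝ) ζ)
    simpa [he, EuclideanSpace.inner_single_left] using this
  have hco : HasDerivAt (fun t : ℝ => (u + t • e) j) 1 0 := by
    have : (fun t : ℝ => (u + t • e) j) = fun t => u j + t := by
      ext t; simp [he]
    rw [this]
    simpa using (hasDerivAt_id (0:ℝ)).const_add (u j)
  have := ((hr (lam + 2)).mul_const (ζ j)).sub ((hr lam).mul (hin.mul hco))
  unfold HasLineDerivAt bb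
  refine this.congr_deriv ?_
  simp only [Pi.mul_apply, zero_smul, add_zero, bd]
  rw [Real.rpow_add h0, Real.rpow_two]
  field_simp
  ring

lemma grad_apply (f : SchwartzMap E3 ℝ) (v : E3) (j : Fin 3) :
    gradient (f : E3 → ℝ) v j = dd j f v := by
  rw [dd_apply, ← inner_gradient_left, EuclideanSpace.inner_single_right]
  simp

lemma vec_apply {lam : ℝ} (hlam : 0 ≤ lam) (u w : E3) (i : Fin 3) :
    (‖u‖ ^ (lam + 2) • (w - (⟪u, w⟫ / ‖u‖ ^ 2) • u)) i = ∑ j, aa lam i j u * w j := by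
  by_cases hu : u = 0
  · have : lam + 2 ≠ 0 := by linarith
    simp [hu, aa, this]
  have h0 : 0 < ‖u‖ := norm_pos_iff.mpr hu
  have e : ‖u‖ ^ lam = ‖u‖ ^ (lam + 2) / ‖u‖ ^ 2 := by
    rw [Real.rpow_add h0, Real.rpow_two]; field_simp
  simp only [aa, e, inner3, Fin.sum_univ_three]
  fin_cases i <;> simp <;> ring

lemma F_apply {lam : ℝ} (hlam : 0 ≤ lam) (f : SchwartzMap E3 ℝ) (v : E3) (i : Fin 3) :
    (∫ vs : E3,
        (‖v - vs‖ ^ (lam + 2) : ℝ) •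
          ((f vs • gradient (f : E3 → ℝ) v - f v • gradient (f : E3 → ℝ) vs) -
            (⟪v - vs, f vs • gradient (f : E3 → ℝ) v -
                f v • gradient (f : E3 → ℝ) vs⟫ / ‖v - vs‖ ^ 2) • (v - vs))) i =
    ∑ j, (dd j f v * cv (aa lam i j) f v - f v * cv (aa lam i j) (dd j f) v) := by
  rw [← integral_sub_left_eq_self _ volume v]
  have hI : ∀ i j, Integrable (fun u => dd j f v * (aa lam i j u * f (v - u)) -
      f v * (aa lam i j u * dd j f (v - u))) := fun i j =>
    ((int_conv (aa_gr hlam i j) f v).const_mul _).sub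
      ((int_conv (aa_gr hlam i j) (dd j f) v).const_mul _)
  have e : ∀ u : E3, ∀ i, ((‖v - (v - u)‖ ^ (lam + 2) : ℝ) •
          ((f (v - u) • gradient (f : E3 → ℝ) v - f v • gradient (f : E3 → ℝ) (v - u)) -
            (⟪v - (v - u), f (v - u) • gradient (f : E3 → ℝ) v -
                f v • gradient (f : E3 → ℝ) (v - u)⟫ / ‖v - (v - u)‖ ^ 2) • (v - (v - u)))) i =
      ∑ j, (dd j f v * (aa lam i j u * f (v - u)) - f v * (aa lam i j u * dd j f (v - u))) := by
    intro u i
    rw [sub_sub_cancel, vec_apply hlam]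
    refine Finset.sum_congr rfl fun j _ => ?_
    rw [PiLp.sub_apply, PiLp.smul_apply, PiLp.smul_apply, grad_apply, grad_apply]
    simp only [smul_eq_mul]
    ring
  rw [eval_integral_piLp]
  · simp only [e]
    rw [integral_finsetSum _ fun j _ => hI i j]
    refine Finset.sum_congr rfl fun j _ => ?_
    have h1 : Integrable (fun u => dd j f v * (aa lam i j u * f (v - u))) :=
      (int_conv (aa_gr hlam i j) f v).const_mul _
    have h2 : Integrable (fun u => f v * (aa lam i j u * dd j f (v - u))) :=
      (int_conv (aa_gr hlam i j) (dd j f) v).const_mul _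
    rw [integral_sub h1 h2, integral_const_mul, integral_const_mul]
    rfl
  · intro i
    simp only [e]
    exact integrable_finsetSum _ fun j _ => hI i j

lemma QL_eq {lam : ℝ} (hlam : 0 ≤ lam) (f : SchwartzMap E3 ℝ) (F : E3 → E3)
    (hFi : ∀ v i, F v i = ∑ j, (dd j f v * cv (aa lam i j) f v -
      f v * cv (aa lam i j) (dd j f) v)) (v : E3) (i : Fin 3) :
    fderiv ℝ F v (EuclideanSpace.single i 1) i =
      ∑ j, ((dd i (dd j f) v * cv (aa lam i j) f v + dd j f v * cv (aa lam i j) (dd i f) v) -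
        (dd i f v * cv (aa lam i j) (dd j f) v + f v * cv (aa lam i j) (dd i (dd j f)) v)) := by
  have hc : ∀ i, ∃ L : E3 →L[ℝ] ℝ, HasFDerivAt (fun v => F v i) L v ∧
      ∀ k, L (EuclideanSpace.single k 1) =
      ∑ j, ((dd k (dd j f) v * cv (aa lam i j) f v + dd j f v * cv (aa lam i j) (dd k f) v) -
        (dd k f v * cv (aa lam i j) (dd j f) v + f v * cv (aa lam i j) (dd k (dd j f)) v)) := by
    intro i
    choose L1 h1 h1' using fun j => pcv_line (aa_gr hlam i j) (dd j f) f v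
    choose L2 h2 h2' using fun j => pcv_line (aa_gr hlam i j) f (dd j f) v
    refine ⟨∑ j, (L1 j - L2 j), ?_, fun k => ?_⟩
    · simp only [hFi]
      exact HasFDerivAt.fun_sum fun j _ => (h1 j).sub (h2 j)
    · simp [h1', h2']
  have hd : DifferentiableAt ℝ F v := by
    rw [differentiableAt_euclidean]
    intro i
    obtain ⟨L, hL, -⟩ := hc i
    exact hL.differentiableAt
  obtain ⟨L, hL, hL'⟩ := hc i
  have h3 : HasFDerivAt (fun v => F v i) ((EuclideanSpace.proj i : E3 →L[ℝ] ℝ).comp (fderiv ℝ F v)) v :=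
    (EuclideanSpace.proj i : E3 →L[ℝ] ℝ).hasFDerivAt.comp v hd.hasFDerivAt
  rw [← hL', hL.unique h3]
  rfl

lemma integral_QL {lam : ℝ} (hlam : 0 ≤ lam) (f : SchwartzMap E3 ℝ) (F : E3 → E3)
    (hFi : ∀ v i, F v i = ∑ j, (dd j f v * cv (aa lam i j) f v -
      f v * cv (aa lam i j) (dd j f) v)) (QL : E3 → ℝ)
    (hQL : ∀ v, QL v = ∑ i : Fin 3, fderiv ℝ F v (EuclideanSpace.single i 1) i) (ζ : E3) :
    ∫ v, (QL v : ℂ) * ph ζ v =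
      ∑ i, ∑ j, Complex.I * (ζ i : ℂ) * (T ζ (aa lam i j) (dd j f) f - T ζ (aa lam i j) f (dd j f)) := by
  have e : ∀ v, (QL v : ℂ) * ph ζ v = ∑ i, ∑ j,
      (((((dd i (dd j f) v * cv (aa lam i j) f v : ℝ) : ℂ) * ph ζ v +
        ((dd j f v * cv (aa lam i j) (dd i f) v : ℝ) : ℂ) * ph ζ v)) -
        (((dd i f v * cv (aa lam i j) (dd j f) v : ℝ) : ℂ) * ph ζ v +
          ((f v * cv (aa lam i j) (dd i (dd j f)) v : ℝ) : ℂ) * ph ζ v)) := by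
    intro v
    rw [hQL]
    simp only [QL_eq hlam f F hFi]
    push_cast
    rw [Finset.sum_mul]
    refine Finset.sum_congr rfl fun i _ => ?_
    rw [Finset.sum_mul]
    refine Finset.sum_congr rfl fun j _ => ?_
    ring
  simp only [e]
  have hA := fun i j => (int_T ζ (aa_gr hlam i j) (dd i (dd j f)) f)
  have hB := fun i j => (int_T ζ (aa_gr hlam i j) (dd j f) (dd i f))
  have hC := fun i j => (int_T ζ (aa_gr hlam i j) (dd i f) (dd j f))
  have hD := fun i j => (int_T ζ (aa_gr hlam i j) f (dd i (dd j f)))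
  have hAB := fun i j => (hA i j).fun_add (hB i j)
  have hCD := fun i j => (hC i j).fun_add (hD i j)
  have hS := fun i j => (hAB i j).sub (hCD i j)
  simp only [Pi.sub_def] at hS
  rw [integral_finsetSum _ fun i _ => integrable_finsetSum _ fun j _ => hS i j]
  refine Finset.sum_congr rfl fun i _ => ?_
  rw [integral_finsetSum _ fun j _ => hS i j]
  refine Finset.sum_congr rfl fun j _ => ?_
  rw [integral_sub (hAB i j) (hCD i j), integral_add (hA i j) (hB i j),
    integral_add (hC i j) (hD i j), mul_sub, ← T_ibp ζ (aa_gr hlam i j), ← T_ibp ζ (aa_gr hlam i j)]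
  rfl

lemma T_final {lam : ℝ} (hlam : 0 ≤ lam) (f : SchwartzMap E3 ℝ) (ζ : E3) :
    ∑ i, ∑ j, Complex.I * (ζ i : ℂ) *
      (T ζ (aa lam i j) (dd j f) f - T ζ (aa lam i j) f (dd j f)) =
    ∫ u, (4 * Complex.I * ((‖u‖ ^ lam * ⟪u, ζ⟫ : ℝ) : ℂ) -
      ((∑ j, ζ j * bb lam ζ j u : ℝ) : ℂ)) * Gh ζ f f u := by
  have hb : ∀ j (p q : SchwartzMap E3 ℝ), T ζ (bb lam ζ j) p q =
      ∑ i, (ζ i : ℂ) * T ζ (aa lam i j) p q := by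
    intro j p q
    rw [bb_eq, T_sum ζ fun i => (Gr.const (ζ i)).mul (aa_gr hlam i j)]
    simp only [T_smul]
  have h1 : ∑ i, ∑ j, Complex.I * (ζ i : ℂ) *
      (T ζ (aa lam i j) (dd j f) f - T ζ (aa lam i j) f (dd j f)) =
      ∑ j, Complex.I * (T ζ (bb lam ζ j) (dd j f) f - T ζ (bb lam ζ j) f (dd j f)) := by
    rw [Finset.sum_comm]
    refine Finset.sum_congr rfl fun j _ => ?_
    rw [hb, hb, ← Finset.sum_sub_distrib, Finset.mul_sum]
    refine Finset.sum_congr rfl fun i _ => ?_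
    ring
  have h2 : ∀ j, Complex.I * (T ζ (bb lam ζ j) (dd j f) f - T ζ (bb lam ζ j) f (dd j f)) =
      (-2 * Complex.I) * T ζ (bd lam ζ j) f f - T ζ (fun u => ζ j * bb lam ζ j u) f f := by
    intro j
    have e1 := T_ibp ζ (bb_gr hlam ζ j) f f j
    have e2 := T_ibp_u ζ (bb_gr hlam ζ j) (bd_gr hlam ζ j) j (bb_line hlam ζ j) f f
    rw [T_smul, ← e2]
    linear_combination Complex.I * e1 + (ζ j : ℂ) * T ζ (bb lam ζ j) f f * Complex.I_sq
  have gB : Gr (fun u => ∑ j, ζ j * bb lam ζ j u) :=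
    Gr.sum fun j => (Gr.const (ζ j)).mul (bb_gr hlam ζ j)
  have gA : Gr (fun u => ‖u‖ ^ lam * ⟪u, ζ⟫) := (Gr.rpow _ hlam).mul (Gr.inner ζ)
  have h3 : ∑ j, T ζ (bd lam ζ j) f f = -2 * T ζ (fun u => ‖u‖ ^ lam * ⟪u, ζ⟫) f f := by
    rw [← T_sum ζ (bd_gr hlam ζ)]
    simp only [bd_sum]
    rw [T_smul]
    push_cast
    rfl
  rw [h1]
  simp only [h2]
  rw [Finset.sum_sub_distrib, ← Finset.mul_sum, h3,
    ← T_sum ζ fun j => (Gr.const (ζ j)).mul (bb_gr hlam ζ j), T_fubini ζ gB, T_fubini ζ gA,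
    ← mul_assoc, ← integral_const_mul,
    ← integral_sub ((int_Gh ζ gA f f).const_mul _) (int_Gh ζ gB f f)]
  congr 1
  ext u
  ring

lemma perp {lam : ℝ} (hlam : 0 ≤ lam) (ζ u : E3) :
    ∑ j, ζ j * bb lam ζ j u =
      ‖u‖ ^ lam * (‖u‖ ^ 2 * ‖ζ - (⟪ζ, u⟫ / ‖u‖ ^ 2) • u‖ ^ 2) := by
  by_cases hu : u = 0
  · have : lam + 2 ≠ 0 := by linarith
    simp [hu, bb, this]
  have h0 : 0 < ‖u‖ := norm_pos_iff.mpr hu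
  rw [norm_sub_sq_real, norm_smul, mul_pow, inner_smul_right, Real.norm_eq_abs, sq_abs]
  have e : ∑ j, ζ j * bb lam ζ j u = ‖u‖ ^ lam * (‖u‖ ^ 2 * ‖ζ‖ ^ 2 - ⟪ζ, u⟫ ^ 2) := by
    simp only [bb, Fin.sum_univ_three]
    rw [Real.rpow_add h0, Real.rpow_two, normsq3 ζ, real_inner_comm ζ u]
    simp only [inner3]
    ring
  rw [e]
  field_simp
  ring

end LandauAux

open LandauAux in
/-- The Fourier transform of the Fokker-Planck-Landau collision
operator is a weighted convolution with weight `4|u|^λ (i u·ζ − ¼|u|²|ζ^⊥|²)`. -/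
theorem landau_fourier_weighted_convolution
    (lam : ℝ) (hlam : 0 ≤ lam)
    (f : SchwartzMap (EuclideanSpace ℝ (Fin 3)) ℝ)
    (F : EuclideanSpace ℝ (Fin 3) → EuclideanSpace ℝ (Fin 3))
    (hF : ∀ v, F v =
      ∫ vs : EuclideanSpace ℝ (Fin 3),
        (‖v - vs‖ ^ (lam + 2) : ℝ) •
          ((f vs • gradient (f : EuclideanSpace ℝ (Fin 3) → ℝ) v -
              f v • gradient (f : EuclideanSpace ℝ (Fin 3) → ℝ) vs) -
            (⟪v - vs, f vs • gradient (f : EuclideanSpace ℝ (Fin 3) → ℝ) v -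
                f v • gradient (f : EuclideanSpace ℝ (Fin 3) → ℝ) vs⟫ / ‖v - vs‖ ^ 2) •
              (v - vs)))
    (QL : EuclideanSpace ℝ (Fin 3) → ℝ)
    (hQL : ∀ v, QL v = ∑ i : Fin 3, fderiv ℝ F v (EuclideanSpace.single i 1) i) :
    ∀ ζ : EuclideanSpace ℝ (Fin 3),
      ((((2 * Real.pi) ^ ((3 : ℝ) / 2))⁻¹ : ℝ) : ℂ) *
          ∫ v : EuclideanSpace ℝ (Fin 3), (QL v : ℂ) * Complex.exp (-Complex.I * ⟪ζ, v⟫) =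
        ∫ u : EuclideanSpace ℝ (Fin 3),
          ((4 * ‖u‖ ^ lam : ℝ) *
              (Complex.I * (⟪u, ζ⟫ : ℝ) -
                ((1/4 : ℝ) * ‖u‖ ^ 2 * ‖ζ - (⟪ζ, u⟫ / ‖u‖ ^ 2) • u‖ ^ 2 : ℝ))) *
            (((((2 * Real.pi) ^ ((3 : ℝ) / 2))⁻¹ : ℝ) : ℂ) *
              ∫ v : EuclideanSpace ℝ (Fin 3),
                ((f v * f (v - u) : ℝ) : ℂ) * Complex.exp (-Complex.I * ⟪ζ, v⟫)) := by
  intro ζ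
  have hFi : ∀ v i, F v i = ∑ j, (dd j f v * cv (aa lam i j) f v -
      f v * cv (aa lam i j) (dd j f) v) := fun v i => by
    rw [hF]; exact F_apply hlam f v i
  have hI := integral_QL hlam f F hFi QL hQL ζ
  have hfin := T_final hlam f ζ
  rw [hfin] at hI
  change _ * ∫ v, (QL v : ℂ) * ph ζ v = _
  rw [hI, ← integral_const_mul]
  congr 1
  ext u
  rw [perp hlam]
  change _ = _ * (_ * Gh ζ f f u)
  push_cast
  ring
end
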